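/- arXiv:2408.09693 — 3 statements merged into one kernel-verified Lean document; each statement's English description precedes it below -/
import Mathlib

section
/- The map γ ↦ γ²·v'(γ) is strictly increasing on (0, γ_max), and there exists γ_D ∈ [0, γ_max] such that the optimal feedback map H* satisfies H*(γ) = 0 for all γ ∈ [0, γ_D] and H* is strictly increasing on [γ_D, γ_max]; γ_D is characterized by: γ²·v'(γ) ≤ c'(0) if and only if γ ≤ γ_D. -/
open MeasureTheory Set Filter Topology

/-- Comparison lemma for an integral differential inequality. -/
lemma aux_cmp (D k : ℝ → ℝ) (hD : ContinuousOn D (Ici 0)) (hk : ContinuousOn k (Ici 0))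
    (h0 : 0 ≤ D 0)
    (h : ∀ s t, 0 ≤ s → s ≤ t → ∫ r in s..t, k r * D r ≤ D t - D s) :
    ∀ t, 0 ≤ t → 0 ≤ D t := by
  intro T hT
  have hsub : Icc (0:ℝ) T ⊆ Ici 0 := fun x hx => hx.1
  obtain ⟨M, hM⟩ := isCompact_Icc.exists_bound_of_continuousOn (hk.mono hsub)
  have key : ∀ ε : ℝ, 0 < ε → -D T ≤ ε * Real.exp ((M + 1) * T) := by
    intro ε hε
    refine image_le_of_liminf_slope_right_lt_deriv_boundary' (f := fun x => -D x)
      (f' := fun x => -(k x * D x)) (a := 0) (b := T)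
      (B := fun x => ε * Real.exp ((M + 1) * x))
      (B' := fun x => ε * (Real.exp ((M + 1) * x) * ((M + 1) * 1)))
      (hD.mono hsub).neg ?_ ?_ ?_ ?_ ?_ (right_mem_Icc.2 hT)
    · intro x hx r hr
      apply Eventually.frequently
      have hx0 : 0 ≤ x := hx.1
      have hkD : ContinuousOn (fun r => k r * D r) (Ici 0) := hk.mul hD
      have hc : Tendsto (fun z => -(k z * D z)) (𝓝[>] x) (𝓝 (-(k x * D x))) := by
        have := ((hkD x hx0).mono (s := Ioi x) (fun z (hz : x < z) => hx0.trans hz.le)).neg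
        exact this
      obtain ⟨r', hr1, hr2⟩ := exists_between hr
      have he := hc.eventually (gt_mem_nhds hr1)
      obtain ⟨u, hu, hu2⟩ := (mem_nhdsGT_iff_exists_Ioo_subset).1 he
      filter_upwards [Ioo_mem_nhdsGT hu] with z hz
      have hxz : 0 < z - x := sub_pos.2 hz.1
      have h1 := h x z hx0 hz.1.le
      have h2 : ∫ r in x..z, (-r') ≤ ∫ r in x..z, k r * D r := by
        apply intervalIntegral.integral_mono_on hz.1.le (by simp)
        · apply ContinuousOn.intervalIntegrable
          apply hkD.mono
          rw [uIcc_of_le hz.1.le]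
          exact fun y hy => hx0.trans hy.1
        · intro y hy
          rcases eq_or_lt_of_le hy.1 with rfl | hy1
          · linarith
          · have : -(k y * D y) < r' := hu2 ⟨hy1, hy.2.trans_lt hz.2⟩
            linarith
      simp only [intervalIntegral.integral_const, smul_eq_mul] at h2
      rw [slope_def_field, div_lt_iff₀ hxz]
      nlinarith
    · simp; linarith
    · fun_prop
    · intro x hx
      apply HasDerivAt.hasDerivWithinAt
      exact (((hasDerivAt_id x).const_mul (M+1)).exp).const_mul ε
    · intro x hx he
      have hb := hM x ⟨hx.1, hx.2.le⟩
      rw [Real.norm_eq_abs, abs_le] at hb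
      have hp := Real.exp_pos ((M+1) * x)
      have hq : 0 < ε * Real.exp ((M+1) * x) := mul_pos hε hp
      have : -(k x * D x) = k x * (ε * Real.exp ((M+1) * x)) := by
        rw [← he]; ring
      simp only [this]
      nlinarith [hb.2]
  by_contra hneg
  push Not at hneg
  have hp := Real.exp_pos ((M+1) * T)
  have := key (-D T / 2 / Real.exp ((M+1) * T)) (by apply div_pos; linarith; exact hp)
  rw [div_mul_cancel₀ _ hp.ne'] at this
  linarith

/-- Chain rule for the reciprocal of an integral function. -/
lemma aux_recip (g F : ℝ → ℝ) (L : ℝ) (hL : ∀ t, 0 ≤ t → |F t| ≤ L)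
    (hc : ContinuousOn g (Ici 0)) (hpos : ∀ t, 0 ≤ t → 0 < g t)
    (hFi : ∀ s t, 0 ≤ s → s ≤ t → IntervalIntegrable F volume s t)
    (hF : ∀ s t, 0 ≤ s → s ≤ t → g t - g s = ∫ r in s..t, F r) :
    ∀ s t, 0 ≤ s → s ≤ t → 1 / g t - 1 / g s = ∫ r in s..t, - F r / g r ^ 2 := by
  intro s t hs hst
  have hsub : Icc s t ⊆ Ici 0 := fun x hx => hs.trans hx.1
  have hL0 : 0 ≤ L := (abs_nonneg _).trans (hL 0 le_rfl)
  have hlip : ∀ x ∈ Icc s t, ∀ y ∈ Icc s t, |g x - g y| ≤ L * |x - y| := by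
    have : ∀ x ∈ Icc s t, ∀ y ∈ Icc s t, x ≤ y → |g y - g x| ≤ L * |y - x| := by
      intro x hx y hy hxy
      rw [hF x y (hsub hx) hxy]
      have := intervalIntegral.norm_integral_le_of_norm_le_const (a := x) (b := y) (f := F)
        (C := L) (by
          intro z hz
          rw [uIoc_of_le hxy] at hz
          exact hL z ((hsub hx).trans hz.1.le))
      simpa using this
    intro x hx y hy
    rcases le_total x y with hxy | hxy
    · rw [abs_sub_comm, abs_sub_comm x y]; exact this x hx y hy hxy
    · exact this y hy x hx hxy
  obtain ⟨x0, hx0, hmin⟩ := isCompact_Icc.exists_isMinOn (nonempty_Icc.2 hst) (hc.mono hsub)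
  have hm : 0 < g x0 := hpos x0 (hsub hx0)
  have hac : AbsolutelyContinuousOnInterval (fun x => 1 / g x) s t := by
    apply LipschitzOnWith.absolutelyContinuousOnInterval (K := (L / (g x0)^2).toNNReal)
    apply LipschitzOnWith.of_dist_le_mul
    rw [uIcc_of_le hst]
    intro x hx y hy
    rw [Real.coe_toNNReal _ (by positivity), Real.dist_eq, Real.dist_eq]
    have hgx := hpos x (hsub hx)
    have hgy := hpos y (hsub hy)
    have h1 : g x0 ≤ g x := hmin hx
    have h2 : g x0 ≤ g y := hmin hy
    rw [div_sub_div _ _ hgx.ne' hgy.ne', abs_div, abs_of_pos (mul_pos hgx hgy),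
      one_mul, mul_one, abs_sub_comm, div_mul_eq_mul_div]
    apply div_le_div₀ (by positivity) (hlip x hx y hy) (by positivity)
    rw [sq]
    exact mul_le_mul h1 h2 hm.le hgx.le
  rw [← hac.integral_deriv_eq_sub]
  apply intervalIntegral.integral_congr_ae
  have h1 : ∀ᵐ x : ℝ, x ≠ t := by simp [ae_iff, measure_singleton]
  filter_upwards [(hFi s t hs hst).ae_hasDerivAt_integral, h1] with x hx hxt hx2
  have hx3 := hx (uIoc_subset_uIcc hx2) s left_mem_uIcc
  rw [uIoc_of_le hst] at hx2
  have hx4 : HasDerivAt g (F x) x := by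
    refine (hx3.const_add (g s)).congr_of_eventuallyEq ?_
    filter_upwards [lt_mem_nhds hx2.1] with y hy
    rw [← hF s y hs hy.le]; ring
  have := (hx4.inv (hpos x (hs.trans hx2.1.le)).ne').deriv
  simp only [one_div]
  exact this

/-- `g` solves the controlled Riccati equation with control `h`. -/
structure AuxSol (A lam s2 G hm : ℝ) (h g : ℝ → ℝ) : Prop where
  meas : Measurable h
  hmem : ∀ t, h t ∈ Icc 0 hm
  cont : ContinuousOn g (Ici 0)
  gmem : ∀ t, 0 ≤ t → g t ∈ Icc 0 G
  eq : ∀ t, 0 ≤ t → g t = g 0 + ∫ s in (0:ℝ)..t, (-(A + h s) * g s ^ 2 - 2 * lam * g s + s2)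

namespace AuxSol

variable {A lam s2 G hm : ℝ} {h g : ℝ → ℝ}

lemma ctrlIntegrable (S : AuxSol A lam s2 G hm h g) (s t : ℝ) : IntervalIntegrable h volume s t := by
  refine (intervalIntegrable_const (c := hm)).mono_fun S.meas.aestronglyMeasurable ?_
  filter_upwards with x
  have := S.hmem x
  rw [Real.norm_eq_abs, Real.norm_eq_abs, abs_of_nonneg this.1]
  exact this.2.trans (le_abs_self _)

lemma fint (S : AuxSol A lam s2 G hm h g) (s t : ℝ) (hs : 0 ≤ s) (hst : s ≤ t) :
    IntervalIntegrable (fun s => -(A + h s) * g s ^ 2 - 2 * lam * g s + s2) volume s t := by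
  have hc : ContinuousOn g (uIcc s t) := by
    rw [uIcc_of_le hst]; exact S.cont.mono (fun x hx => hs.trans hx.1)
  refine IntervalIntegrable.add (IntervalIntegrable.sub ?_ ?_) (by simp)
  · refine IntervalIntegrable.mul_continuousOn ?_ (hc.pow 2)
    exact ((intervalIntegrable_const).add (S.ctrlIntegrable s t)).neg
  · exact (continuousOn_const.mul hc).intervalIntegrable

lemma incr (S : AuxSol A lam s2 G hm h g) (s t : ℝ) (hs : 0 ≤ s) (hst : s ≤ t) :
    g t - g s = ∫ s in s..t, (-(A + h s) * g s ^ 2 - 2 * lam * g s + s2) := by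
  rw [S.eq t (hs.trans hst), S.eq s hs,
    ← intervalIntegral.integral_add_adjacent_intervals (S.fint 0 s le_rfl hs) (S.fint s t hs hst)]
  ring

lemma bound (S : AuxSol A lam s2 G hm h g) (hA : 0 ≤ A) (hl : 0 ≤ lam) (h2 : 0 ≤ s2)
    (t : ℝ) (ht : 0 ≤ t) :
    |(-(A + h t) * g t ^ 2 - 2 * lam * g t + s2)| ≤ (A + hm) * G ^ 2 + 2 * lam * G + s2 := by
  obtain ⟨h0, h1⟩ := S.hmem t
  obtain ⟨g0, g1⟩ := S.gmem t ht
  have e1 : (A + h t) * g t ^ 2 ≤ (A + hm) * G ^ 2 := by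
    have : 0 ≤ A + hm := by linarith
    gcongr
  have e2 : 2 * lam * g t ≤ 2 * lam * G := by gcongr
  have e3 : 0 ≤ (A + h t) * g t ^ 2 := by positivity
  have e4 : 0 ≤ 2 * lam * g t := by positivity
  rw [abs_le]
  constructor <;> linarith

lemma pos (S : AuxSol A lam s2 G hm h g) (hA : 0 ≤ A) (hl : 0 ≤ lam) (h2 : 0 ≤ s2)
    (hg : 0 < g 0) (t : ℝ) (ht : 0 ≤ t) : 0 < g t := by
  set C := (A + hm) * G + 2 * lam with hC
  have key := aux_cmp (fun t => g t - g 0 * Real.exp (-C * t)) (fun _ => -C)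
    (S.cont.sub (by fun_prop)) continuousOn_const (by simp) ?_ t ht
  · have : 0 < g 0 * Real.exp (-C * t) := mul_pos hg (Real.exp_pos _)
    linarith
  · intro s t hs hst
    have hi : ∫ r in s..t, g 0 * (Real.exp (-C * r) * (-C * 1))
        = g 0 * Real.exp (-C * t) - g 0 * Real.exp (-C * s) := by
      apply intervalIntegral.integral_eq_sub_of_hasDerivAt (f := fun r => g 0 * Real.exp (-C * r))
      · intro x _
        exact (((hasDerivAt_id x).const_mul (-C)).exp).const_mul (g 0)
      · exact (by fun_prop : Continuous _).intervalIntegrable _ _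
    have hii : IntervalIntegrable (fun r => g 0 * (Real.exp (-C * r) * (-C * 1))) volume s t :=
      (by fun_prop : Continuous _).intervalIntegrable _ _
    have := S.incr s t hs hst
    have e : g t - g 0 * Real.exp (-C * t) - (g s - g 0 * Real.exp (-C * s)) =
      ∫ r in s..t, ((-(A + h r) * g r ^ 2 - 2 * lam * g r + s2) -
        g 0 * (Real.exp (-C * r) * (-C * 1))) := by
      rw [intervalIntegral.integral_sub (S.fint s t hs hst) hii, hi, ← this]; ring
    rw [e]
    apply intervalIntegral.integral_mono_on hst _ ((S.fint s t hs hst).sub hii)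
    · intro r hr
      have hr0 := hs.trans hr.1
      obtain ⟨h0, h1⟩ := S.hmem r
      obtain ⟨g0, g1⟩ := S.gmem r hr0
      have : (A + h r) * g r ^ 2 ≤ (A + hm) * G * g r := by
        have : 0 ≤ A + hm := by linarith
        rw [sq, ← mul_assoc]; gcongr
      simp only [hC]
      nlinarith
    · apply ContinuousOn.intervalIntegrable
      rw [uIcc_of_le hst]
      exact continuousOn_const.mul ((S.cont.sub (by fun_prop)).mono (fun x hx => hs.trans hx.1))

lemma recip (S : AuxSol A lam s2 G hm h g) (hA : 0 ≤ A) (hl : 0 ≤ lam) (h2 : 0 ≤ s2)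
    (hg : 0 < g 0) (s t : ℝ) (hs : 0 ≤ s) (hst : s ≤ t) :
    1 / g t - 1 / g s = ∫ r in s..t, (h r + (A + 2 * lam * (1 / g r) - s2 * (1 / g r) ^ 2)) := by
  rw [aux_recip g _ _ (S.bound hA hl h2) S.cont (S.pos hA hl h2 hg) S.fint S.incr s t hs hst]
  apply intervalIntegral.integral_congr
  intro r hr
  rw [uIcc_of_le hst] at hr
  have := S.pos hA hl h2 hg r (hs.trans hr.1)
  simp only
  field_simp
  ring

lemma contrecip (S : AuxSol A lam s2 G hm h g) (hA : 0 ≤ A) (hl : 0 ≤ lam) (h2 : 0 ≤ s2)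
    (hg : 0 < g 0) : ContinuousOn (fun t => 1 / g t) (Ici 0) :=
  continuousOn_const.div S.cont (fun t ht => (S.pos hA hl h2 hg t ht).ne')

lemma lip (S : AuxSol A lam s2 G hm h g) (hA : 0 ≤ A) (hl : 0 ≤ lam) (h2 : 0 ≤ s2)
    (t : ℝ) (ht : 0 ≤ t) :
    |g t - g 0| ≤ ((A + hm) * G ^ 2 + 2 * lam * G + s2) * t := by
  rw [S.incr 0 t le_rfl ht]
  have := intervalIntegral.norm_integral_le_of_norm_le_const (a := 0) (b := t)
    (f := fun s => -(A + h s) * g s ^ 2 - 2 * lam * g s + s2)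
        (C := ((A + hm) * G ^ 2 + 2 * lam * G + s2)) (by
          intro z hz
          rw [uIoc_of_le ht] at hz
          exact S.bound hA hl h2 z hz.1.le)
  simpa [abs_of_nonneg ht] using this

end AuxSol

lemma aux_mix {A lam s2 G hm : ℝ} {h₁ g₁ h₂ g₂ g a b : _}
    (hA : 0 ≤ A) (hl : 0 ≤ lam) (h2 : 0 ≤ s2) (ha : 0 ≤ a) (hb : 0 ≤ b) (hab : a + b = 1)
    (S₁ : AuxSol A lam s2 G hm h₁ g₁) (S₂ : AuxSol A lam s2 G hm h₂ g₂)
    (S : AuxSol A lam s2 G hm (fun t => a * h₁ t + b * h₂ t) g)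
    (p₁ : 0 < g₁ 0) (p₂ : 0 < g₂ 0) (p : 0 < g 0)
    (h0 : 1 / g 0 = a * (1 / g₁ 0) + b * (1 / g₂ 0)) (t : ℝ) (ht : 0 ≤ t) :
    a * (1 / g₁ t) + b * (1 / g₂ t) ≤ 1 / g t := by
  have c := S.contrecip hA hl h2 p
  have c₁ := S₁.contrecip hA hl h2 p₁
  have c₂ := S₂.contrecip hA hl h2 p₂
  have cu : ContinuousOn (fun t => a * (1 / g₁ t) + b * (1 / g₂ t)) (Ici 0) :=
    (continuousOn_const.mul c₁).add (continuousOn_const.mul c₂)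
  have key := aux_cmp (fun t => 1 / g t - (a * (1 / g₁ t) + b * (1 / g₂ t)))
    (fun t => 2 * lam - s2 * (1 / g t + (a * (1 / g₁ t) + b * (1 / g₂ t))))
    (c.sub cu) (continuousOn_const.sub (continuousOn_const.mul (c.add cu))) (by linarith)
    ?_ t ht
  · linarith
  intro s t hs hst
  have hsub : uIcc s t ⊆ Ici 0 := by rw [uIcc_of_le hst]; exact fun x hx => hs.trans hx.1
  have ci : ∀ {h g : ℝ → ℝ}, AuxSol A lam s2 G hm h g → 0 < g 0 → IntervalIntegrable
      (fun r => (h r + (A + 2 * lam * (1 / g r) - s2 * (1 / g r) ^ 2))) volume s t := by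
    intro h g S p
    have c := (S.contrecip hA hl h2 p).mono hsub
    refine (S.ctrlIntegrable s t).add (ContinuousOn.intervalIntegrable ?_)
    exact (continuousOn_const.add (continuousOn_const.mul c)).sub (continuousOn_const.mul (c.pow 2))
  have i := ci S p
  have i₁ := (ci S₁ p₁).const_mul a
  have i₂ := (ci S₂ p₂).const_mul b
  have e := S.recip hA hl h2 p s t hs hst
  have e₁ := S₁.recip hA hl h2 p₁ s t hs hst
  have e₂ := S₂.recip hA hl h2 p₂ s t hs hst
  have E : 1 / g t - (a * (1 / g₁ t) + b * (1 / g₂ t)) -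
      (1 / g s - (a * (1 / g₁ s) + b * (1 / g₂ s))) =
      (1 / g t - 1 / g s) - (a * (1 / g₁ t - 1 / g₁ s) + b * (1 / g₂ t - 1 / g₂ s)) := by ring
  rw [E, e, e₁, e₂, ← intervalIntegral.integral_const_mul, ← intervalIntegral.integral_const_mul,
    ← intervalIntegral.integral_add i₁ i₂, ← intervalIntegral.integral_sub i (i₁.add i₂)]
  apply intervalIntegral.integral_mono_on hst _ (i.sub (i₁.add i₂))
  · intro r hr
    generalize 1 / g r = u
    generalize 1 / g₁ r = x
    generalize 1 / g₂ r = y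
    obtain rfl : b = 1 - a := by linarith
    have : 0 ≤ s2 * (a * (1 - a) * (x - y) ^ 2) := by positivity
    nlinarith
  · apply ContinuousOn.intervalIntegrable
    exact ((continuousOn_const.sub (continuousOn_const.mul (c.add cu))).mul (c.sub cu)).mono hsub

lemma aux_gain {a b x y G : ℝ} (ha : 0 < a) (hb : 0 < b) (hab : a + b = 1)
    (hx : 0 < x) (hy : 0 < y) (hxG : x ≤ G) (hyG : y ≤ G) {z : ℝ} (hz : 0 < z)
    (h : a * (1 / x) + b * (1 / y) ≤ 1 / z) :
    z + a * b * (x - y) ^ 2 / G ≤ a * x + b * y := by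
  have hp : 0 < a * y + b * x := by positivity
  have h1 : z ≤ x * y / (a * y + b * x) := by
    rw [le_div_iff₀ hp]
    have e : a * (1 / x) + b * (1 / y) = (a * y + b * x) / (x * y) := by field_simp
    rw [e, div_le_div_iff₀ (by positivity) hz] at h
    linarith
  have h2 : a * b * (x - y) ^ 2 / G ≤ a * b * (x - y) ^ 2 / (a * y + b * x) := by
    apply div_le_div_of_nonneg_left (by positivity) hp
    nlinarith
  have h3 : x * y / (a * y + b * x) + a * b * (x - y) ^ 2 / (a * y + b * x) = a * x + b * y := by
    rw [← add_div, div_eq_iff hp.ne']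
    obtain rfl : b = 1 - a := by linarith
    ring
  linarith

lemma AuxSol.integrable {A lam s2 G hm : ℝ} {h g c : ℝ → ℝ} {δ abar : ℝ}
    (S : AuxSol A lam s2 G hm h g) (hδ : 0 < δ)
    (hc0 : ∀ x : ℝ, 0 ≤ x → 0 ≤ c x) (hcm : StrictMonoOn c (Ici 0)) :
    IntegrableOn (fun t => Real.exp (-δ * t) * (abar * g t + c (h t))) (Ioi 0) := by
  have hmeas : Measurable (fun t => c (h t)) := by
    have hm : Monotone (fun x => c (max 0 x)) := by
      intro x y hxy
      exact hcm.monotoneOn (mem_Ici.2 (le_max_left _ _)) (mem_Ici.2 (le_max_left _ _)) (max_le_max le_rfl hxy)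
    have := hm.measurable.comp S.meas
    convert! this using 2 with t
    simp [(S.hmem t).1]
  have hexp : IntegrableOn (fun t => Real.exp (-δ * t)) (Ioi 0) := exp_neg_integrableOn_Ioi 0 hδ
  refine Integrable.mul_bdd (c := |abar| * G + c hm) hexp ?_ ?_
  · refine AEStronglyMeasurable.add ?_ hmeas.aestronglyMeasurable
    apply ContinuousOn.aestronglyMeasurable _ measurableSet_Ioi
    exact continuousOn_const.mul (S.cont.mono Ioi_subset_Ici_self)
  · rw [ae_restrict_iff' measurableSet_Ioi]
    filter_upwards with t ht
    have ht0 : (0:ℝ) ≤ t := le_of_lt ht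
    obtain ⟨h0, h1⟩ := S.hmem t
    obtain ⟨g0, g1⟩ := S.gmem t ht0
    have e1 : c (h t) ≤ c hm := hcm.monotoneOn h0 (h0.trans h1) h1
    calc ‖abar * g t + c (h t)‖ ≤ ‖abar * g t‖ + ‖c (h t)‖ := norm_add_le _ _
      _ = |abar| * g t + c (h t) := by
        rw [Real.norm_eq_abs, Real.norm_eq_abs, abs_mul, abs_of_nonneg g0, abs_of_nonneg (hc0 _ h0)]
      _ ≤ _ := by gcongr

/-- Strict gain, uniform in the controls. -/
lemma aux_J {A lam s2 G hm δ abar a b x y : ℝ} {c : ℝ → ℝ}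
    (hA : 0 ≤ A) (hl : 0 ≤ lam) (h2 : 0 ≤ s2) (hδ : 0 < δ) (habar : 0 < abar)
    (hG : 0 < G) (hm0 : 0 ≤ hm)
    (hc0 : ∀ x : ℝ, 0 ≤ x → 0 ≤ c x) (hcm : StrictMonoOn c (Ici 0))
    (hcc : StrictConvexOn ℝ (Ici 0) c)
    (ha : 0 < a) (hb : 0 < b) (hab : a + b = 1) (hx : 0 < x) (hy : 0 < y) (hxy : x ≠ y) :
    ∃ κ > 0, ∀ h₁ g₁ h₂ g₂ g : ℝ → ℝ,
      AuxSol A lam s2 G hm h₁ g₁ → AuxSol A lam s2 G hm h₂ g₂ →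
      AuxSol A lam s2 G hm (fun t => a * h₁ t + b * h₂ t) g →
      g₁ 0 = x → g₂ 0 = y → 0 < g 0 → 1 / g 0 = a * (1 / x) + b * (1 / y) →
      (∫ t in Ioi (0:ℝ), Real.exp (-δ * t) * (abar * g t + c (a * h₁ t + b * h₂ t))) + κ ≤
      a * (∫ t in Ioi (0:ℝ), Real.exp (-δ * t) * (abar * g₁ t + c (h₁ t))) +
      b * (∫ t in Ioi (0:ℝ), Real.exp (-δ * t) * (abar * g₂ t + c (h₂ t))) := by
  set L := (A + hm) * G ^ 2 + 2 * lam * G + s2 + 1 with hL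
  have hLpos : 0 < L := by positivity
  have hd : 0 < |x - y| := abs_pos.2 (sub_ne_zero.2 hxy)
  set T := |x - y| / (4 * L) with hT
  have hTpos : 0 < T := by positivity
  set q := abar * (a * b * (|x - y| / 2) ^ 2 / G) * Real.exp (-δ * T) with hq
  have hqpos : 0 < q := by positivity
  refine ⟨q * T, by positivity, ?_⟩
  intro h₁ g₁ h₂ g₂ g S₁ S₂ S e₁ e₂ p e
  subst e₁ e₂
  have I := S.integrable (abar := abar) hδ hc0 hcm
  have I₁ := (S₁.integrable (abar := abar) hδ hc0 hcm).const_mul a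
  have I₂ := (S₂.integrable (abar := abar) hδ hc0 hcm).const_mul b
  have hInd : Integrable (indicator (Ioc 0 T) (fun _ => q)) (volume.restrict (Ioi (0:ℝ))) := by
    apply Integrable.mono_measure _ Measure.restrict_le_self
    rw [integrable_indicator_iff measurableSet_Ioc]
    simp
  have hI2 : ∫ t in Ioi (0:ℝ), indicator (Ioc 0 T) (fun _ => q) t = q * T := by
    rw [setIntegral_indicator measurableSet_Ioc, inter_eq_right.2 Ioc_subset_Ioi_self]
    simp [hTpos.le, mul_comm]
  rw [← hI2, ← integral_const_mul, ← integral_const_mul, ← integral_add I hInd,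
    ← integral_add I₁ I₂]
  apply setIntegral_mono_on (I.add hInd) (I₁.add I₂) measurableSet_Ioi
  intro t ht
  have ht0 : (0:ℝ) ≤ t := le_of_lt ht
  have q₁ := S₁.pos hA hl h2 hx t ht0
  have q₂ := S₂.pos hA hl h2 hy t ht0
  have q₀ := S.pos hA hl h2 p t ht0
  have hmix := aux_mix hA hl h2 ha.le hb.le hab S₁ S₂ S hx hy p e t ht0
  have hgain := aux_gain ha hb hab q₁ q₂ (S₁.gmem t ht0).2 (S₂.gmem t ht0).2 q₀ hmix
  have hcv := hcc.convexOn.2 (S₁.hmem t).1 (S₂.hmem t).1 ha.le hb.le hab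
  simp only [smul_eq_mul] at hcv
  have hE := Real.exp_pos (-δ * t)
  have hind : indicator (Ioc 0 T) (fun _ => q) t ≤
      Real.exp (-δ * t) * (abar * (a * b * (g₁ t - g₂ t) ^ 2 / G)) := by
    by_cases htT : t ∈ Ioc 0 T
    · rw [indicator_of_mem htT, hq, mul_comm]
      have l₁ := abs_le.1 (S₁.lip hA hl h2 t ht0)
      have l₂ := abs_le.1 (S₂.lip hA hl h2 t ht0)
      have hLt : ((A + hm) * G ^ 2 + 2 * lam * G + s2) * t ≤ |g₁ 0 - g₂ 0| / 4 := by
        calc _ ≤ L * T := by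
              apply mul_le_mul _ htT.2 ht0 hLpos.le
              rw [hL]; linarith
          _ = _ := by rw [hT]; field_simp
      have hdist : |g₁ 0 - g₂ 0| / 2 ≤ |g₁ t - g₂ t| := by
        rcases abs_cases (g₁ 0 - g₂ 0) with ⟨h, _⟩ | ⟨h, _⟩ <;>
        rcases abs_cases (g₁ t - g₂ t) with ⟨h', _⟩ | ⟨h', _⟩ <;> linarith [l₁.1, l₁.2, l₂.1, l₂.2]
      rw [← sq_abs (g₁ t - g₂ t)]
      have : Real.exp (-δ * T) ≤ Real.exp (-δ * t) := by
        apply Real.exp_le_exp.2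
        nlinarith [htT.2]
      gcongr
    · rw [indicator_of_notMem htT]
      positivity
  have hfin : abar * g t + c (a * h₁ t + b * h₂ t) + abar * (a * b * (g₁ t - g₂ t) ^ 2 / G)
     ≤ a * (abar * g₁ t + c (h₁ t)) + b * (abar * g₂ t + c (h₂ t)) := by
    have := mul_le_mul_of_nonneg_left hgain habar.le
    linarith
  have := mul_le_mul_of_nonneg_left hfin hE.le
  simp only [Pi.add_apply]
  linarith

lemma aux_strictmono {S : Set ℝ} {f f' : ℝ → ℝ} (hf : StrictConvexOn ℝ S f)
    (h : ∀ x ∈ S, HasDerivWithinAt f (f' x) S x) : StrictMonoOn f' S := by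
  intro x hx y hy hxy
  exact (hf.lt_slope_of_hasDerivWithinAt hx hy hxy (h x hx)).trans
    (hf.slope_lt_of_hasDerivWithinAt hx hy hxy (h y hy))

theorem stmt_15
    (σ₁ σ₂ lam δ abar γmax hmax : ℝ)
    (hσ₁ : 0 < σ₁) (hσ₂ : 0 ≤ σ₂) (hlam : 0 ≤ lam) (hδ : 0 < δ) (habar : 0 < abar)
    (f : ℝ → ℝ → ℝ)
    (hf : ∀ γ h : ℝ, f γ h = -(1 / σ₁ ^ 2 + h) * γ ^ 2 - 2 * lam * γ + σ₂ ^ 2)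
    (γinf : ℝ)
    (hγinf : γinf = -lam * σ₁ ^ 2 + Real.sqrt (lam ^ 2 * σ₁ ^ 4 + σ₁ ^ 2 * σ₂ ^ 2))
    (hγmax : γinf < γmax)
    (c c' : ℝ → ℝ)
    (hc_nonneg : ∀ x : ℝ, 0 ≤ x → 0 ≤ c x)
    (hc_conv : StrictConvexOn ℝ (Set.Ici 0) c)
    (hc_mono : StrictMonoOn c (Set.Ici 0))
    (hc_smooth : ContDiffOn ℝ 2 c (Set.Ici 0))
    (hc_deriv : ∀ x ∈ Set.Ici (0 : ℝ), HasDerivWithinAt c (c' x) (Set.Ici 0) x)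
    (hhmax : 0 < hmax) (hc_hmax : c' hmax = γmax ^ 2 * (abar / δ))
    (Adm : (ℝ → ℝ) → Prop)
    (hAdm : ∀ h : ℝ → ℝ, Adm h ↔ Measurable h ∧ ∀ t : ℝ, h t ∈ Set.Icc 0 hmax)
    (sol : (ℝ → ℝ) → ℝ → ℝ → ℝ)
    (hsol : ∀ h : ℝ → ℝ, Adm h → ∀ γ₀ ∈ Set.Icc (0 : ℝ) γmax,
      sol h γ₀ 0 = γ₀ ∧
      ContinuousOn (sol h γ₀) (Set.Ici 0) ∧
      (∀ t ∈ Set.Ici (0 : ℝ), sol h γ₀ t ∈ Set.Icc 0 γmax) ∧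
      (∀ t ∈ Set.Ici (0 : ℝ),
        sol h γ₀ t = γ₀ + ∫ s in (0 : ℝ)..t, f (sol h γ₀ s) (h s)))
    (J : (ℝ → ℝ) → ℝ → ℝ)
    (hJ : ∀ (h : ℝ → ℝ) (γ₀ : ℝ), J h γ₀ =
      ∫ t in Set.Ioi (0 : ℝ), Real.exp (-δ * t) * (abar * sol h γ₀ t + c (h t)))
    (v : ℝ → ℝ)
    (hv : ∀ γ₀ ∈ Set.Icc (0 : ℝ) γmax,
      v γ₀ = sInf ((fun h => J h γ₀) '' {h : ℝ → ℝ | Adm h}))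
    (v' : ℝ → ℝ)
    (hv_conc : ConcaveOn ℝ (Set.Icc 0 γmax) v)
    (hv'_deriv : ∀ x ∈ Set.Ioo (0 : ℝ) γmax, HasDerivAt v (v' x) x)
    (hv'_cont : ContinuousOn v' (Set.Ioo 0 γmax))
    (hv'_zero : HasDerivWithinAt v (v' 0) (Set.Icc 0 γmax) 0)
    (hv'_gmax : HasDerivWithinAt v (v' γmax) (Set.Icc 0 γmax) γmax)
    (Hstar : ℝ → ℝ)
    (hHstar : ∀ γ ∈ Set.Icc (0 : ℝ) γmax,
      (γ ^ 2 * v' γ < c' 0 → Hstar γ = 0) ∧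
      (c' 0 ≤ γ ^ 2 * v' γ →
        Hstar γ ∈ Set.Icc (0 : ℝ) hmax ∧ c' (Hstar γ) = γ ^ 2 * v' γ))
    : StrictMonoOn (fun γ => γ ^ 2 * v' γ) (Set.Ioo 0 γmax) ∧
      ∃ γD ∈ Set.Icc (0 : ℝ) γmax,
        (∀ γ ∈ Set.Icc (0 : ℝ) γD, Hstar γ = 0) ∧
        StrictMonoOn Hstar (Set.Icc γD γmax) ∧
        (∀ γ ∈ Set.Icc (0 : ℝ) γmax, γ ^ 2 * v' γ ≤ c' 0 ↔ γ ≤ γD) := by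
  have hγinf0 : 0 ≤ γinf := by
    have : lam * σ₁ ^ 2 ≤ Real.sqrt (lam ^ 2 * σ₁ ^ 4 + σ₁ ^ 2 * σ₂ ^ 2) := by
      apply Real.le_sqrt_of_sq_le
      have : 0 ≤ σ₁ ^ 2 * σ₂ ^ 2 := by positivity
      nlinarith
    rw [hγinf]; linarith
  have hG : 0 < γmax := hγinf0.trans_lt hγmax
  have hA : 0 ≤ 1 / σ₁ ^ 2 := by positivity
  have hs2 : 0 ≤ σ₂ ^ 2 := by positivity
  have hS : ∀ h : ℝ → ℝ, Adm h → ∀ γ₀ ∈ Set.Icc (0 : ℝ) γmax,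
      AuxSol (1 / σ₁ ^ 2) lam (σ₂ ^ 2) γmax hmax h (sol h γ₀) := by
    intro h hh γ₀ hγ
    obtain ⟨h0, h1, h2, h3⟩ := hsol h hh γ₀ hγ
    obtain ⟨m1, m2⟩ := (hAdm h).1 hh
    refine ⟨m1, m2, h1, h2, ?_⟩
    intro t ht
    rw [h0, h3 t ht]
    simp only [hf]
  have hAdm0 : Adm (fun _ => 0) := (hAdm _).2 ⟨measurable_const, fun _ => ⟨le_rfl, hhmax.le⟩⟩
  have hJ0 : ∀ h, Adm h → ∀ γ₀ ∈ Set.Icc (0 : ℝ) γmax, 0 ≤ J h γ₀ := by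
    intro h hh γ₀ hγ
    rw [hJ]
    apply setIntegral_nonneg measurableSet_Ioi
    intro t ht
    have h1 := ((hS h hh γ₀ hγ).gmem t (le_of_lt ht)).1
    have h2 := hc_nonneg _ ((hS h hh γ₀ hγ).hmem t).1
    positivity
  -- strict convexity in the reciprocal variable
  have hV : StrictConvexOn ℝ (Ici (1 / γmax)) (fun u => v (1 / u)) := by
    refine ⟨convex_Ici _, ?_⟩
    intro u hu w hw huw a b ha hb hab
    have hGi : 0 < 1 / γmax := by positivity
    have hu0 : 0 < u := hGi.trans_le hu
    have hw0 : 0 < w := hGi.trans_le hw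
    have hm1 : 1 / γmax ≤ a * u + b * w := by
      have h1 : a * (1 / γmax) ≤ a * u := mul_le_mul_of_nonneg_left hu ha.le
      have h2 : b * (1 / γmax) ≤ b * w := mul_le_mul_of_nonneg_left hw hb.le
      have h3 : a * (1 / γmax) + b * (1 / γmax) = 1 / γmax := by rw [← add_mul, hab, one_mul]
      linarith
    have hinv : ∀ z, 1 / γmax ≤ z → 1 / z ∈ Icc 0 γmax := by
      intro z hz
      have : 0 < z := hGi.trans_le hz
      refine ⟨by positivity, ?_⟩
      rw [div_le_iff₀ this]
      rw [div_le_iff₀ hG] at hz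
      linarith
    have mu := hinv u hu
    have mw := hinv w hw
    have mm := hinv _ hm1
    have hm0 : 0 < a * u + b * w := hGi.trans_le hm1
    obtain ⟨κ, hκ, hgain⟩ := aux_J (G := γmax) (hm := hmax) (c := c) (x := 1 / u) (y := 1 / w)
      hA hlam hs2 hδ habar hG hhmax.le hc_nonneg hc_mono hc_conv ha hb hab
      (by positivity) (by positivity) (by
        intro h
        apply huw
        have := congrArg (fun z => 1 / z) h
        simpa using this)
    have happ : ∀ γ₀ ∈ Icc 0 γmax, ∃ h, Adm h ∧ J h γ₀ < v γ₀ + κ / 2 := by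
      intro γ₀ hγ
      have hne : ((fun h => J h γ₀) '' {h : ℝ → ℝ | Adm h}).Nonempty := ⟨_, _, hAdm0, rfl⟩
      obtain ⟨_, ⟨h, hh, rfl⟩, hlt⟩ := exists_lt_of_csInf_lt hne
        (show sInf _ < v γ₀ + κ / 2 by rw [← hv γ₀ hγ]; linarith)
      exact ⟨h, hh, hlt⟩
    obtain ⟨h₁, A₁, j₁⟩ := happ _ mu
    obtain ⟨h₂, A₂, j₂⟩ := happ _ mw
    have A₀ : Adm (fun t => a * h₁ t + b * h₂ t) := by
      obtain ⟨m₁, n₁⟩ := (hAdm _).1 A₁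
      obtain ⟨m₂, n₂⟩ := (hAdm _).1 A₂
      refine (hAdm _).2 ⟨(m₁.const_mul a).add (m₂.const_mul b), fun t => ?_⟩
      exact convex_Icc (0:ℝ) hmax (n₁ t) (n₂ t) ha.le hb.le hab
    have z₁ := (hsol h₁ A₁ _ mu).1
    have z₂ := (hsol h₂ A₂ _ mw).1
    have z₀ := (hsol _ A₀ _ mm).1
    have hg := hgain h₁ _ h₂ _ _ (hS _ A₁ _ mu) (hS _ A₂ _ mw) (hS _ A₀ _ mm) z₁ z₂
      (by rw [z₀]; positivity) (by rw [z₀]; simp)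
    have k₁ := hJ h₁ (1 / u)
    have k₂ := hJ h₂ (1 / w)
    have k₀ := hJ (fun t => a * h₁ t + b * h₂ t) (1 / (a * u + b * w))
    rw [← k₁, ← k₂, ← k₀] at hg
    have hle : v (1 / (a * u + b * w)) ≤ J (fun t => a * h₁ t + b * h₂ t) (1 / (a * u + b * w)) := by
      rw [hv _ mm]
      apply csInf_le
      · refine ⟨0, ?_⟩
        rintro _ ⟨h, hh, rfl⟩
        exact hJ0 h hh _ mm
      · exact ⟨_, A₀, rfl⟩
    simp only [smul_eq_mul]
    have f₁ := mul_lt_mul_of_pos_left j₁ ha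
    have f₂ := mul_lt_mul_of_pos_left j₂ hb
    have f₃ : a * (κ / 2) + b * (κ / 2) = κ / 2 := by rw [← add_mul, hab, one_mul]
    linarith
  -- derivative within the closed interval
  have hvd : ∀ x ∈ Icc 0 γmax, HasDerivWithinAt v (v' x) (Icc 0 γmax) x := by
    intro x hx
    rcases eq_or_lt_of_le hx.1 with h0 | h0
    · rw [← h0]; exact hv'_zero
    rcases eq_or_lt_of_le hx.2 with h1 | h1
    · rw [h1]; exact hv'_gmax
    · exact (hv'_deriv x ⟨h0, h1⟩).hasDerivWithinAt
  have hVd : ∀ u ∈ Ici (1 / γmax), HasDerivWithinAt (fun u => v (1 / u))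
      (v' (1 / u) * (-(u ^ 2)⁻¹)) (Ici (1 / γmax)) u := by
    intro u hu
    have hGi : 0 < 1 / γmax := by positivity
    have hu0 : 0 < u := hGi.trans_le hu
    have hmaps : MapsTo (fun u : ℝ => 1 / u) (Ici (1 / γmax)) (Icc 0 γmax) := by
      intro z hz
      have hz' : 1 / γmax ≤ z := hz
      have : 0 < z := hGi.trans_le hz
      refine ⟨by positivity, ?_⟩
      rw [div_le_iff₀ this]
      rw [div_le_iff₀ hG] at hz'
      linarith
    have hd : HasDerivWithinAt (fun u : ℝ => 1 / u) (-(u ^ 2)⁻¹) (Ici (1 / γmax)) u := by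
      simpa [one_div] using (hasDerivAt_inv hu0.ne').hasDerivWithinAt
    exact (hvd (1 / u) (hmaps hu)).comp u hd hmaps
  have hmonoV := aux_strictmono hV hVd
  have hw1 : ∀ x y, 0 < x → x < y → y ≤ γmax → x ^ 2 * v' x < y ^ 2 * v' y := by
    intro x y hx hxy hy
    have hy0 := hx.trans hxy
    have := hmonoV (a := 1 / y) (one_div_le_one_div_of_le hy0 hy) (b := 1 / x)
      (one_div_le_one_div_of_le hx (hxy.le.trans hy)) (one_div_lt_one_div_of_lt hx hxy)
    simp at this
    linarith
  -- concavity: `v'` is antitone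
  have hanti : ∀ x y, 0 ≤ x → x < y → y ≤ γmax → v' y ≤ v' x := by
    intro x y hx hxy hy
    have mx : x ∈ Icc 0 γmax := ⟨hx, hxy.le.trans hy⟩
    have my : y ∈ Icc 0 γmax := ⟨hx.trans hxy.le, hy⟩
    exact (hv_conc.le_slope_of_hasDerivWithinAt mx my hxy (hvd y my)).trans
      (hv_conc.slope_le_of_hasDerivWithinAt mx my hxy (hvd x mx))
  have hwnn : ∀ y, 0 < y → y ≤ γmax → 0 ≤ y ^ 2 * v' y := by
    intro y hy0 hy
    have ht : Tendsto (fun x : ℝ => x ^ 2 * v' y) (𝓝[>] 0) (𝓝 0) := by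
      have : Continuous (fun x : ℝ => x ^ 2 * v' y) := by fun_prop
      have h := (this.tendsto 0).mono_left (nhdsWithin_le_nhds (s := Ioi 0))
      simpa using h
    refine le_of_tendsto ht ?_
    filter_upwards [Ioo_mem_nhdsGT hy0] with x hx
    have h1 := hanti x y hx.1.le hx.2 hy
    have h2 := hw1 x y hx.1 hx.2 hy
    have h3 := mul_le_mul_of_nonneg_left h1 (sq_nonneg x)
    linarith
  have hw : StrictMonoOn (fun γ => γ ^ 2 * v' γ) (Icc 0 γmax) := by
    intro x hx y hy hxy
    rcases eq_or_lt_of_le hx.1 with h0 | h0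
    · subst h0
      have h1 := hwnn (y / 2) (by linarith) (by linarith [hy.2])
      have h2 := hw1 (y / 2) y (by linarith) (by linarith) hy.2
      linarith
    · exact hw1 x y h0 hxy hy.2
  have hcderivMono : StrictMonoOn c' (Ici 0) := aux_strictmono hc_conv hc_deriv
  have hcderivZero : 0 ≤ c' 0 := by
    have h0 : (0:ℝ) ∈ Ici (0:ℝ) := self_mem_Ici
    have ht := (hasDerivWithinAt_iff_tendsto_slope' (self_notMem_Ioi)).1
      ((hc_deriv 0 h0).mono Ioi_subset_Ici_self)
    refine ge_of_tendsto ht ?_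
    filter_upwards [self_mem_nhdsWithin] with x hx
    have hx' : (0:ℝ) < x := hx
    rw [slope_def_field]
    exact div_nonneg (sub_nonneg.2 (hc_mono h0 hx'.le hx').le) (by linarith)
  refine ⟨hw.mono Ioo_subset_Icc_self, ?_⟩
  set E := {γ : ℝ | γ ∈ Icc 0 γmax ∧ γ ^ 2 * v' γ ≤ c' 0} with hE
  have h0E : (0:ℝ) ∈ E := ⟨⟨le_rfl, hG.le⟩, by simpa using hcderivZero⟩
  have hEb : BddAbove E := ⟨γmax, fun x hx => hx.1.2⟩
  have hD0 : 0 ≤ sSup E := le_csSup hEb h0E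
  have hDm : sSup E ≤ γmax := csSup_le ⟨0, h0E⟩ (fun x hx => hx.1.2)
  have hbelow : ∀ γ, 0 ≤ γ → γ < sSup E → γ ^ 2 * v' γ ≤ c' 0 := by
    intro γ h0 hlt
    obtain ⟨y, hy, hγy⟩ := exists_lt_of_lt_csSup ⟨0, h0E⟩ hlt
    exact (hw ⟨h0, hγy.le.trans hy.1.2⟩ hy.1 hγy).le.trans hy.2
  have hat : (sSup E) ^ 2 * v' (sSup E) ≤ c' 0 := by
    rcases eq_or_lt_of_le hD0 with h | h
    · rw [← h]; simpa using hcderivZero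
    -- concavity gives left lower semicontinuity
    set D := sSup E with hDdef
    have ht : Tendsto (fun x : ℝ => x ^ 2 * v' D) (𝓝[<] D) (𝓝 (D ^ 2 * v' D)) := by
      have : Continuous (fun x : ℝ => x ^ 2 * v' D) := by fun_prop
      exact (this.tendsto D).mono_left nhdsWithin_le_nhds
    refine le_of_tendsto ht ?_
    filter_upwards [Ioo_mem_nhdsLT h] with x hx
    have h1 := hanti x D hx.1.le hx.2 hDm
    have h2 := hbelow x hx.1.le hx.2
    have h3 := mul_le_mul_of_nonneg_left h1 (sq_nonneg x)
    linarith
  have hchar : ∀ γ ∈ Icc (0 : ℝ) γmax, γ ^ 2 * v' γ ≤ c' 0 ↔ γ ≤ sSup E := by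
    intro γ hγ
    constructor
    · intro h
      exact le_csSup hEb ⟨hγ, h⟩
    · intro h
      rcases eq_or_lt_of_le h with h | h
      · rw [h]; exact hat
      · exact hbelow γ hγ.1 h
  have hH0 : ∀ γ ∈ Icc (0 : ℝ) (sSup E), Hstar γ = 0 := by
    intro γ hγ
    have hγ' : γ ∈ Icc 0 γmax := ⟨hγ.1, hγ.2.trans hDm⟩
    have hle := (hchar γ hγ').2 hγ.2
    rcases eq_or_lt_of_le hle with h | h
    · obtain ⟨h1, h2⟩ := (hHstar γ hγ').2 h.ge
      exact hcderivMono.injOn h1.1 (self_mem_Ici) (h2.trans h)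
    · exact (hHstar γ hγ').1 h
  refine ⟨sSup E, ⟨hD0, hDm⟩, hH0, ?_, hchar⟩
  intro x hx y hy hxy
  have mx : x ∈ Icc 0 γmax := ⟨hD0.trans hx.1, hx.2⟩
  have my : y ∈ Icc 0 γmax := ⟨hD0.trans hy.1, hy.2⟩
  have hyD : sSup E < y := hx.1.trans_lt hxy
  have hcy : c' 0 < y ^ 2 * v' y := by
    by_contra hcon
    push Not at hcon
    exact absurd ((hchar y my).1 hcon) (not_le.2 hyD)
  obtain ⟨y1, y2⟩ := (hHstar y my).2 hcy.le
  by_cases hcx : c' 0 ≤ x ^ 2 * v' x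
  · obtain ⟨x1, x2⟩ := (hHstar x mx).2 hcx
    rw [← hcderivMono.lt_iff_lt x1.1 y1.1, x2, y2]
    exact hw mx my hxy
  · have x0 := (hHstar x mx).1 (not_le.1 hcx)
    rw [← hcderivMono.lt_iff_lt (x0 ▸ (le_rfl : (0:ℝ) ≤ 0)) y1.1, x0, y2]
    exact hcy
end

section
/- For every γ₀ ∈ [0, γ_max], the solution γ* of the feedback equation γ'(t) = f(γ(t), H*(γ(t))), γ(0) = γ₀, is monotone in t and converges to γ_eq as t → ∞, and the optimal control h*(t) := H*(γ*(t)) is monotone in t and converges to h_eq := H*(γ_eq) as t → ∞; in particular the limits γ_eq and h_eq do not depend on γ₀. Moreover γ_eq ≤ γ∞⁰ and γ_eq = 0 if and only if σ₂ = 0. -/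
open Set Filter Topology MeasureTheory

/-- Trajectories of a scalar autonomous equation starting to the right of the equilibrium. -/
lemma traj_right {a b e : ℝ} {x G : ℝ → ℝ}
    (hx : ∀ t ∈ Ici (0 : ℝ), x t ∈ Icc a b ∧ HasDerivWithinAt x (G (x t)) (Ici 0) t)
    (hGe : G e = 0)
    (hpos : ∀ y ∈ Ico a e, 0 < G y)
    (hneg : ∀ y ∈ Ioc e b, G y < 0)
    (hanti : ∀ L ∈ Ioc e b, ∀ y ∈ Icc L b, G y ≤ G L)
    (h0 : e ≤ x 0) :
    AntitoneOn x (Ici 0) ∧ Tendsto x atTop (𝓝 e) := by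
  have hcont : ContinuousOn x (Ici 0) := fun t ht => (hx t ht).2.continuousWithinAt
  have hge : ∀ t ∈ Ici (0 : ℝ), e ≤ x t := by
    intro t ht
    refine le_of_forall_pos_le_add fun ε hε => ?_
    have := image_le_of_deriv_right_lt_deriv_boundary' (f := fun t => - x t)
      (f' := fun t => - G (x t)) (a := 0) (b := t) (B := fun _ => -e + ε) (B' := fun _ => 0)
      ((hcont.mono Icc_subset_Ici_self).neg)
      (fun s hs => ((hx s hs.1).2.mono (Ici_subset_Ici.2 hs.1)).neg)
      (by simp; linarith) continuousOn_const (fun s _ => hasDerivWithinAt_const _ _ _)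
      (by
        intro s hs hh
        have h1 := (hx s hs.1).1
        have := hpos (x s) ⟨h1.1, by linarith⟩
        linarith) (right_mem_Icc.2 ht)
    linarith
  have hanti' : AntitoneOn x (Ici 0) := by
    refine antitoneOn_of_hasDerivWithinAt_nonpos (convex_Ici 0) hcont
      (f' := fun t => G (x t)) (fun t ht => ?_) (fun t ht => ?_)
    · exact (hx t (interior_subset ht)).2.mono interior_subset
    · have ht' : t ∈ Ici (0:ℝ) := interior_subset ht
      rcases (hge t ht').eq_or_lt with h | h
      · rw [← h, hGe]
      · exact (hneg _ ⟨h, (hx t ht').1.2⟩).le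
  refine ⟨hanti', ?_⟩
  rw [Metric.tendsto_atTop]
  intro ε hε
  obtain ⟨T, hT, hxT⟩ : ∃ T ∈ Ici (0:ℝ), x T < e + ε := by
    by_contra! hcon
    set L := e + ε
    have hL : L ∈ Ioc e b := ⟨by simp [L, hε], (hcon 0 self_mem_Ici).trans (hx 0 self_mem_Ici).1.2⟩
    have hm := hneg L hL
    have key : AntitoneOn (fun t => x t - G L * t) (Ici 0) := by
      refine antitoneOn_of_hasDerivWithinAt_nonpos (convex_Ici 0) (by fun_prop)
        (f' := fun t => G (x t) - G L * 1) (fun t ht => ?_) (fun t ht => ?_)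
      · exact ((hx t (interior_subset ht)).2.mono interior_subset).sub
          ((hasDerivWithinAt_id _ _).const_mul _)
      · have ht' : t ∈ Ici (0:ℝ) := interior_subset ht
        have := hanti L hL (x t) ⟨hcon t ht', (hx t ht').1.2⟩
        linarith
    have hT : (0:ℝ) ≤ (x 0 - a + 1) / (-G L) := by
      have := (hx 0 self_mem_Ici).1.1
      exact div_nonneg (by linarith) (by linarith)
    have h2 := key self_mem_Ici hT hT
    have h3 := (hx _ hT).1.1
    have h4 : G L * ((x 0 - a + 1) / (-G L)) = -(x 0 - a + 1) := by
      have := hm.ne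
      field_simp
    simp only [mul_zero] at h2
    rw [h4] at h2
    linarith
  refine ⟨T, fun t ht => ?_⟩
  have ht0 : t ∈ Ici (0:ℝ) := le_trans hT ht
  have h1 := hanti' hT ht0 ht
  have h2 := hge t ht0
  rw [Real.dist_eq, abs_lt]
  constructor <;> linarith

lemma traj_left {a b e : ℝ} {x G : ℝ → ℝ}
    (hx : ∀ t ∈ Ici (0 : ℝ), x t ∈ Icc a b ∧ HasDerivWithinAt x (G (x t)) (Ici 0) t)
    (hGe : G e = 0)
    (hpos : ∀ y ∈ Ico a e, 0 < G y)
    (hneg : ∀ y ∈ Ioc e b, G y < 0)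
    (hanti : ∀ L ∈ Ico a e, ∀ y ∈ Icc a L, G L ≤ G y)
    (h0 : x 0 ≤ e) :
    MonotoneOn x (Ici 0) ∧ Tendsto x atTop (𝓝 e) := by
  have := traj_right (a := -b) (b := -a) (e := -e) (x := fun t => - x t) (G := fun y => - G (-y))
    (by
      intro t ht
      obtain ⟨h1, h2⟩ := hx t ht
      refine ⟨⟨by linarith [h1.2], by linarith [h1.1]⟩, ?_⟩
      have h3 := h2.neg
      simp only [neg_neg]
      exact h3)
    (by simp [hGe])
    (by
      intro y hy
      have := hneg (-y) ⟨by linarith [hy.2], by linarith [hy.1]⟩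
      linarith)
    (by
      intro y hy
      have := hpos (-y) ⟨by linarith [hy.2], by linarith [hy.1]⟩
      linarith)
    (by
      intro L hL y hy
      have := hanti (-L) ⟨by linarith [hL.2], by linarith [hL.1]⟩ (-y)
        ⟨by linarith [hy.2], by linarith [hy.1]⟩
      linarith)
    (by simpa using h0)
  refine ⟨fun s hs t ht hst => ?_, ?_⟩
  · have := this.1 hs ht hst
    simp only at this
    linarith
  · simpa using this.2.neg

lemma intInt {φ h : ℝ → ℝ} {M : ℝ} (hφ : Continuous φ) (hh : Measurable h)
    (hb : ∀ t, h t ∈ Icc 0 M) (a b : ℝ) :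
    IntervalIntegrable (fun s => h s * φ s) volume a b := by
  have h1 : IntervalIntegrable φ volume a b := hφ.intervalIntegrable a b
  rw [intervalIntegrable_iff] at h1 ⊢
  refine Integrable.bdd_mul (c := M) h1 hh.aestronglyMeasurable ?_
  refine Eventually.of_forall fun t => ?_
  rw [Real.norm_eq_abs, abs_of_nonneg (hb t).1]
  exact (hb t).2

/-- Right derivative of `1/g - ∫ h`. -/
lemma recip_deriv {p l q M g0 : ℝ} {g h : ℝ → ℝ} (hg : Continuous g) (hh : Measurable h)
    (hb : ∀ t, h t ∈ Icc 0 M) (hgpos : ∀ t, 0 < g t)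
    (heq : ∀ t, 0 ≤ t → g t = g0 + ∫ s in (0:ℝ)..t, (-(p + h s) * g s ^ 2 - 2 * l * g s + q))
    {t : ℝ} (ht : 0 ≤ t) :
    HasDerivWithinAt (fun s => 1 / g s - ∫ r in (0:ℝ)..s, h r)
      (p + 2 * l * (1 / g t) - q * (1 / g t) ^ 2) (Ici t) t := by
  set A : ℝ → ℝ := fun s => ∫ r in (0:ℝ)..s, h r with hA
  have hkInt : ∀ a b, IntervalIntegrable h volume a b := by
    intro a b
    simpa using intInt (φ := fun _ => 1) continuous_const hh hb a b
  set φ : ℝ → ℝ := fun r => (-p * g r ^ 2 - 2 * l * g r + q) + h r * (g t ^ 2 - g r ^ 2) with hφ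
  have hφint : ∀ a b, IntervalIntegrable φ volume a b := by
    intro a b
    exact (Continuous.intervalIntegrable (by fun_prop) a b).add
      (intInt (φ := fun r => g t ^ 2 - g r ^ 2) (by fun_prop) hh hb a b)
  have hφm : Measurable φ := by
    have := hg.measurable
    fun_prop
  have hzero : Tendsto (fun r => h r * (g t ^ 2 - g r ^ 2)) (𝓝 t) (𝓝 0) := by
    refine bdd_le_mul_tendsto_zero (b := 0) (B := M) (Eventually.of_forall fun r => (hb r).1)
      (Eventually.of_forall fun r => (hb r).2) ?_
    have : Continuous fun r => g t ^ 2 - g r ^ 2 := by fun_prop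
    simpa using this.tendsto t
  have hφc : ContinuousAt φ t := by
    have h1 : ContinuousAt (fun r => (-p * g r ^ 2 - 2 * l * g r + q)) t := by fun_prop
    refine ContinuousAt.add h1 ?_
    simpa [ContinuousAt] using hzero
  have hd := intervalIntegral.integral_hasDerivAt_right (hφint 0 t)
    hφm.stronglyMeasurable.stronglyMeasurableAtFilter hφc
  -- u
  have hu : HasDerivWithinAt (fun s => g s + g t ^ 2 * A s) (φ t) (Ici t) t := by
    have h2 : HasDerivWithinAt (fun s => g0 + ∫ x in (0:ℝ)..s, φ x) (φ t) (Ici t) t :=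
      (hd.const_add g0).hasDerivWithinAt
    have h3 : ∀ s ∈ Ici t, g s + g t ^ 2 * A s = g0 + ∫ x in (0:ℝ)..s, φ x := by
      intro s hs
      have hs0 : 0 ≤ s := le_trans ht hs
      have hfi : IntervalIntegrable (fun s => -(p + h s) * g s ^ 2 - 2 * l * g s + q)
          volume 0 s := by
        have := (Continuous.intervalIntegrable (μ := volume)
          (u := fun r => (-p * g r ^ 2 - 2 * l * g r + q)) (by fun_prop) 0 s).add
          (intInt (φ := fun r => - g r ^ 2) (by fun_prop) hh hb 0 s)
        refine this.congr (fun r _ => ?_)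
        ring
      rw [heq s hs0, hA]
      simp only
      rw [← intervalIntegral.integral_const_mul, add_assoc,
        ← intervalIntegral.integral_add hfi ((hkInt 0 s).const_mul _)]
      congr 1
      refine intervalIntegral.integral_congr fun r _ => ?_
      simp only [hφ]
      ring
    exact h2.congr h3 (h3 t self_mem_Ici)
  rw [hasDerivWithinAt_iff_tendsto_slope] at hu ⊢
  rw [Ici_sdiff_left] at hu ⊢
  have hgt := (hgpos t).ne'
  have hgw : Tendsto g (𝓝[>] t) (𝓝 (g t)) := hg.continuousAt.mono_left nhdsWithin_le_nhds
  have hsl : ∀ᶠ s in 𝓝[>] t, slope A t s ∈ Icc 0 M := by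
    filter_upwards [self_mem_nhdsWithin] with s hs
    have hs' : t < s := hs
    have h1 : A s - A t = ∫ r in t..s, h r :=
      intervalIntegral.integral_interval_sub_left (hkInt 0 s) (hkInt 0 t)
    rw [slope_def_field, h1]
    have h2 : 0 ≤ ∫ r in t..s, h r :=
      intervalIntegral.integral_nonneg hs'.le fun r _ => (hb r).1
    have h3 : ∫ r in t..s, h r ≤ ∫ r in t..s, M :=
      intervalIntegral.integral_mono_on hs'.le (hkInt t s) (by simp) fun r _ => (hb r).2
    rw [intervalIntegral.integral_const, smul_eq_mul] at h3
    have h4 : 0 < s - t := by linarith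
    refine ⟨by positivity, ?_⟩
    rw [div_le_iff₀ h4]
    linarith
  have hz : Tendsto (fun s => slope A t s * (g t / g s - 1)) (𝓝[>] t) (𝓝 0) := by
    refine bdd_le_mul_tendsto_zero (hsl.mono fun _ h => h.1) (hsl.mono fun _ h => h.2) ?_
    have : Tendsto (fun s => g t / g s - 1) (𝓝[>] t) (𝓝 (g t / g t - 1)) :=
      (tendsto_const_nhds.div hgw hgt).sub_const 1
    simpa [div_self hgt] using this
  have hmain : Tendsto (fun s => - (slope (fun s => g s + g t ^ 2 * A s) t s) / (g s * g t)
      + slope A t s * (g t / g s - 1)) (𝓝[>] t) (𝓝 (-(φ t) / (g t * g t) + 0)) :=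
    (hu.neg.div (hgw.mul_const _) (mul_ne_zero hgt hgt)).add hz
  have hval : -(φ t) / (g t * g t) + 0 = p + 2 * l * (1 / g t) - q * (1 / g t) ^ 2 := by
    simp only [hφ]
    field_simp
    ring
  rw [← hval]
  refine hmain.congr' ?_
  filter_upwards [self_mem_nhdsWithin] with s hs
  have hs' : s - t ≠ 0 := by have : t < s := hs; linarith
  have hgs := (hgpos s).ne'
  have eA : ∀ r, (∫ x in (0:ℝ)..r, h x) = A r := fun _ => rfl
  simp only [slope_def_field, eA]
  generalize A s = X
  generalize A t = Y
  field_simp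
  ring

/-- Positivity of solutions. -/
lemma sol_pos {p l q M G : ℝ} {g h : ℝ → ℝ} (hp : 0 ≤ p) (hl : 0 ≤ l) (hq : 0 ≤ q)
    (hg : Continuous g) (hh : Measurable h)
    (hb : ∀ t, h t ∈ Icc 0 M) (hgG : ∀ t, g t ∈ Icc 0 G) (hg0 : 0 < g 0)
    (heq : ∀ t, 0 ≤ t → g t = g 0 + ∫ s in (0:ℝ)..t, (-(p + h s) * g s ^ 2 - 2 * l * g s + q))
    {t : ℝ} (ht : 0 ≤ t) : 0 < g t := by
  have hG0 : 0 ≤ G := (hgG 0).1.trans (hgG 0).2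
  have hM0 : 0 ≤ M := (hb 0).1.trans (hb 0).2
  set F : ℝ → ℝ := fun s => -(p + h s) * g s ^ 2 - 2 * l * g s + q with hF
  have hfi : ∀ a b, IntervalIntegrable F volume a b := by
    intro a b
    have := (Continuous.intervalIntegrable (μ := volume)
      (u := fun r => (-p * g r ^ 2 - 2 * l * g r + q)) (by fun_prop) a b).add
      (intInt (φ := fun r => - g r ^ 2) (by fun_prop) hh hb a b)
    refine this.congr (fun r _ => ?_)
    simp only [hF]
    ring
  set K := (p + M) * G + 2 * l with hK
  by_contra hcon
  have hgt : g t = 0 := le_antisymm (not_lt.1 hcon) (hgG t).1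
  have hle : ∀ s ∈ Icc 0 t, g s ≤ K * ∫ r in s..t, g r := by
    intro s hs
    have h1 : g t - g s = ∫ r in s..t, F r := by
      rw [heq t ht, heq s hs.1, add_sub_add_left_eq_sub]
      exact intervalIntegral.integral_interval_sub_left (hfi 0 t) (hfi 0 s)
    have h2 : ∫ r in s..t, -K * g r ≤ ∫ r in s..t, F r := by
      refine intervalIntegral.integral_mono_on hs.2
        (Continuous.intervalIntegrable (by fun_prop) _ _) (hfi s t) fun r _ => ?_
      simp only [hF, hK]
      have a1 := hb r
      have a2 := hgG r
      have a3 : (p + h r) * g r ^ 2 ≤ (p + M) * G * g r := by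
        have : (p + h r) * g r ≤ (p + M) * G :=
          mul_le_mul (by linarith [a1.2]) a2.2 a2.1 (by linarith)
        nlinarith [mul_le_mul_of_nonneg_right this a2.1]
      nlinarith
    rw [intervalIntegral.integral_const_mul] at h2
    linarith
  set R : ℝ → ℝ := fun s => ∫ r in s..t, g r with hR
  have hRd : ∀ s, HasDerivAt R (- g s) s := fun s =>
    intervalIntegral.integral_hasDerivAt_left (hg.intervalIntegrable _ _)
      hg.measurable.stronglyMeasurable.stronglyMeasurableAtFilter hg.continuousAt
  have hEd : ∀ s, HasDerivAt (fun s => Real.exp (K * s) * R s)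
      (Real.exp (K * s) * (K * 1) * R s + Real.exp (K * s) * (- g s)) s := fun s =>
    (((hasDerivAt_id s).const_mul K).exp).mul (hRd s)
  have hmono : MonotoneOn (fun s => Real.exp (K * s) * R s) (Icc 0 t) := by
    refine monotoneOn_of_hasDerivWithinAt_nonneg (convex_Icc 0 t)
      (fun s _ => (hEd s).continuousAt.continuousWithinAt)
      (fun s _ => (hEd s).hasDerivWithinAt) (fun s hs => ?_)
    have := hle s (interior_subset hs)
    have e := Real.exp_pos (K * s)
    have : 0 ≤ Real.exp (K * s) * (K * R s - g s) := mul_nonneg e.le (by simp only [hR]; linarith)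
    linarith
  have h5 := hmono (left_mem_Icc.2 ht) (right_mem_Icc.2 ht) ht
  have h6 := hle 0 (left_mem_Icc.2 ht)
  have h7 : R t = 0 := by simp [hR]
  simp only [h7, mul_zero, Real.exp_zero, one_mul] at h5
  have hK0 : 0 ≤ K := by positivity
  have : K * R 0 ≤ 0 := mul_nonpos_of_nonneg_of_nonpos hK0 h5
  simp only [hR] at this
  linarith

/-- Comparison of reciprocals. -/
lemma recip_compare {p l q M a b : ℝ} {g g₁ g₂ h h₁ h₂ : ℝ → ℝ}
    (hq : 0 ≤ q) (ha : 0 ≤ a) (hb : 0 ≤ b) (hab : a + b = 1)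
    (hg : Continuous g) (hg₁ : Continuous g₁) (hg₂ : Continuous g₂)
    (mh : Measurable h) (mh₁ : Measurable h₁) (mh₂ : Measurable h₂)
    (bh : ∀ t, h t ∈ Icc 0 M) (bh₁ : ∀ t, h₁ t ∈ Icc 0 M) (bh₂ : ∀ t, h₂ t ∈ Icc 0 M)
    (pg : ∀ t, 0 < g t) (pg₁ : ∀ t, 0 < g₁ t) (pg₂ : ∀ t, 0 < g₂ t)
    (eg : ∀ t, 0 ≤ t → g t = g 0 + ∫ s in (0:ℝ)..t, (-(p + h s) * g s ^ 2 - 2 * l * g s + q))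
    (eg₁ : ∀ t, 0 ≤ t →
      g₁ t = g₁ 0 + ∫ s in (0:ℝ)..t, (-(p + h₁ s) * g₁ s ^ 2 - 2 * l * g₁ s + q))
    (eg₂ : ∀ t, 0 ≤ t →
      g₂ t = g₂ 0 + ∫ s in (0:ℝ)..t, (-(p + h₂ s) * g₂ s ^ 2 - 2 * l * g₂ s + q))
    (hh : ∀ t, h t = a * h₁ t + b * h₂ t)
    (h0 : 1 / g 0 = a * (1 / g₁ 0) + b * (1 / g₂ 0)) {t : ℝ} (ht : 0 ≤ t) :
    a * (1 / g₁ t) + b * (1 / g₂ t) ≤ 1 / g t := by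
  have hkInt : ∀ {k : ℝ → ℝ}, Measurable k → (∀ t, k t ∈ Icc 0 M) → ∀ x y,
      IntervalIntegrable k volume x y := by
    intro k hk hkb x y
    simpa using intInt (φ := fun _ => 1) continuous_const hk hkb x y
  set D : ℝ → ℝ := fun s => a * (1 / g₁ s) + b * (1 / g₂ s) - 1 / g s with hD
  have hDd : ∀ s, 0 ≤ s → HasDerivWithinAt D
      (a * (p + 2 * l * (1 / g₁ s) - q * (1 / g₁ s) ^ 2)
        + b * (p + 2 * l * (1 / g₂ s) - q * (1 / g₂ s) ^ 2)
        - (p + 2 * l * (1 / g s) - q * (1 / g s) ^ 2)) (Ici s) s := by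
    intro s hs
    have := (((recip_deriv hg₁ mh₁ bh₁ pg₁ eg₁ hs).const_mul a).add
      ((recip_deriv hg₂ mh₂ bh₂ pg₂ eg₂ hs).const_mul b)).sub
      (recip_deriv hg mh bh pg eg hs)
    have hA : ∀ r, ∫ x in (0:ℝ)..r, h x =
        a * (∫ x in (0:ℝ)..r, h₁ x) + b * (∫ x in (0:ℝ)..r, h₂ x) := by
      intro r
      rw [← intervalIntegral.integral_const_mul, ← intervalIntegral.integral_const_mul,
        ← intervalIntegral.integral_add ((hkInt mh₁ bh₁ _ _).const_mul _)
          ((hkInt mh₂ bh₂ _ _).const_mul _)]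
      exact intervalIntegral.integral_congr fun x _ => hh x
    refine this.congr_of_eventuallyEq (Eventually.of_forall fun r => ?_) ?_ <;>
    · simp only [hD, Pi.add_apply, Pi.sub_apply, hA]
      ring
  have hDc : Continuous D := by
    have := fun t => (pg t).ne'
    have := fun t => (pg₁ t).ne'
    have := fun t => (pg₂ t).ne'
    fun_prop (disch := assumption)
  suffices hs : D t ≤ 0 by simp only [hD] at hs; linarith
  refine le_of_forall_pos_le_add fun ε hε => ?_
  set k := 2 * l + 1 with hk
  set η := ε * Real.exp (-(k * t)) with hη
  have hη0 : 0 < η := by positivity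
  have hB : ∀ s, HasDerivAt (fun s => η * Real.exp (k * s)) (η * (Real.exp (k * s) * (k * 1))) s :=
    fun s => (((hasDerivAt_id s).const_mul k).exp).const_mul η
  have := image_le_of_deriv_right_lt_deriv_boundary (f := D) (a := 0) (b := t)
    hDc.continuousOn (fun s hs => hDd s hs.1) (B := fun s => η * Real.exp (k * s))
    (by simp only [hD, mul_zero, Real.exp_zero]; linarith) hB
    (by
      intro s hs hDB
      have hpos : 0 < η * Real.exp (k * s) := by positivity
      have y₁ := one_div_pos.2 (pg₁ s)
      have y₂ := one_div_pos.2 (pg₂ s)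
      have y := one_div_pos.2 (pg s)
      have e1 : η * (Real.exp (k * s) * (k * 1)) = 2 * l * D s + D s := by rw [hDB, hk]; ring
      rw [e1]
      have hDp : 0 < D s := by rw [hDB]; exact hpos
      simp only [hD] at hDp ⊢
      generalize 1 / g₁ s = u at *
      generalize 1 / g₂ s = w at *
      generalize 1 / g s = z at *
      have hconv : (a * u + b * w) ^ 2 ≤ a * u ^ 2 + b * w ^ 2 := by
        have hb' : b = 1 - a := by linarith
        have : a * u ^ 2 + b * w ^ 2 - (a * u + b * w) ^ 2 = a * b * (u - w) ^ 2 := by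
          subst hb'; ring
        have : 0 ≤ a * b * (u - w) ^ 2 := by positivity
        linarith
      have hsq : z ^ 2 ≤ (a * u + b * w) ^ 2 := by
        apply pow_le_pow_left₀ y.le; linarith
      have hqq : 0 ≤ q * (a * u ^ 2 + b * w ^ 2 - z ^ 2) := mul_nonneg hq (by linarith)
      have : a * (p + 2 * l * u - q * u ^ 2) + b * (p + 2 * l * w - q * w ^ 2)
          - (p + 2 * l * z - q * z ^ 2) = (a + b - 1) * p + 2 * l * (a * u + b * w - z)
          - q * (a * u ^ 2 + b * w ^ 2 - z ^ 2) := by ring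
      rw [this, hab]
      linarith) (right_mem_Icc.2 ht)
  have e : η * Real.exp (k * t) = ε := by
    rw [hη, mul_assoc, ← Real.exp_add]; simp
  simp only [e] at this
  linarith

lemma cost_integrable {δ abar γmax hmax : ℝ} (hδ : 0 < δ) (habar : 0 < abar) {c γ h : ℝ → ℝ}
    (hc0 : ∀ x : ℝ, 0 ≤ x → 0 ≤ c x) (hc : StrictMonoOn c (Ici 0)) (hγ : ContinuousOn γ (Ici 0))
    (hγb : ∀ t ∈ Ici (0:ℝ), γ t ∈ Icc 0 γmax) (hh : Measurable h) (hb : ∀ t, h t ∈ Icc 0 hmax) :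
    IntegrableOn (fun t => Real.exp (-δ * t) * (abar * γ t + c (h t))) (Ioi 0) := by
  have h1 : IntegrableOn (fun t => Real.exp (-δ * t)) (Ioi 0) := exp_neg_integrableOn_Ioi 0 hδ
  have hcm : Measurable fun x => c (max x 0) := by
    refine Monotone.measurable fun x y hxy => ?_
    exact hc.monotoneOn (mem_Ici.2 (le_max_right _ _)) (mem_Ici.2 (le_max_right _ _))
      (max_le_max_right _ hxy)
  have hch : Measurable fun t => c (h t) := by
    have : (fun t => c (h t)) = fun t => c (max (h t) 0) := by
      funext t; rw [max_eq_left (hb t).1]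
    rw [this]
    exact hcm.comp hh
  have hm : AEStronglyMeasurable (fun t => abar * γ t + c (h t)) (volume.restrict (Ioi 0)) :=
    (((hγ.mono Ioi_subset_Ici_self).aestronglyMeasurable measurableSet_Ioi).const_mul _).add
      hch.aestronglyMeasurable
  have := Integrable.bdd_mul (c := abar * γmax + c hmax) h1 hm (by
    refine (ae_restrict_iff' measurableSet_Ioi).2 (Eventually.of_forall fun t ht => ?_)
    have a1 := hγb t (Ioi_subset_Ici_self ht)
    have a2 := hb t
    have a3 := hc0 _ a2.1
    have a4 : 0 ≤ abar * γ t := mul_nonneg habar.le a1.1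
    have a5 : c (h t) ≤ c hmax := hc.monotoneOn a2.1 (a2.1.trans a2.2) a2.2
    have a6 : abar * γ t ≤ abar * γmax := mul_le_mul_of_nonneg_left a1.2 habar.le
    rw [Real.norm_eq_abs, abs_of_nonneg (by linarith)]
    linarith)
  refine this.congr (Eventually.of_forall fun t => ?_)
  exact mul_comm _ _

/-- Harmonic mean below arithmetic mean. -/
lemma harm_le {a b x₁ x₂ x : ℝ} (ha : 0 ≤ a) (hb : 0 ≤ b) (hab : a + b = 1)
    (h₁ : 0 < x₁) (h₂ : 0 < x₂) (h : 0 < x) (hx : a * (1 / x₁) + b * (1 / x₂) ≤ 1 / x) :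
    x ≤ a * x₁ + b * x₂ := by
  have t₁ : 2 * x - x ^ 2 * (1 / x₁) ≤ x₁ := by
    have : x₁ - (2 * x - x ^ 2 * (1 / x₁)) = (x₁ - x) ^ 2 / x₁ := by field_simp; ring
    have : 0 ≤ (x₁ - x) ^ 2 / x₁ := by positivity
    linarith
  have t₂ : 2 * x - x ^ 2 * (1 / x₂) ≤ x₂ := by
    have : x₂ - (2 * x - x ^ 2 * (1 / x₂)) = (x₂ - x) ^ 2 / x₂ := by field_simp; ring
    have : 0 ≤ (x₂ - x) ^ 2 / x₂ := by positivity
    linarith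
  have t₃ := mul_le_mul_of_nonneg_left hx (sq_nonneg x)
  have t₄ : x ^ 2 * (1 / x) = x := by field_simp
  rw [t₄] at t₃
  have u₁ := mul_le_mul_of_nonneg_left t₁ ha
  have u₂ := mul_le_mul_of_nonneg_left t₂ hb
  have : a * (2 * x - x ^ 2 * (1 / x₁)) + b * (2 * x - x ^ 2 * (1 / x₂))
    = (a + b) * (2 * x) - x ^ 2 * (a * (1 / x₁) + b * (1 / x₂)) := by ring
  rw [hab] at this
  linarith

/-- For every γ₀ ∈ [0, γ_max], the solution γ* of the feedback equation
γ' = f(γ, H*(γ)), γ(0) = γ₀, is monotone in t and converges to γ_eq as t → ∞, and the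
optimal control h* = H*(γ*) is monotone in t and converges to h_eq = H*(γ_eq); the
limits do not depend on γ₀. Moreover γ_eq ≤ γ∞⁰, and γ_eq = 0 iff σ₂ = 0. -/
theorem stmt_17
    (σ₁ σ₂ lam δ abar γmax hmax : ℝ)
    (hσ₁ : 0 < σ₁) (hσ₂ : 0 ≤ σ₂) (hlam : 0 ≤ lam) (hδ : 0 < δ) (habar : 0 < abar)
    (f : ℝ → ℝ → ℝ)
    (hf : ∀ γ h : ℝ, f γ h = -(1 / σ₁ ^ 2 + h) * γ ^ 2 - 2 * lam * γ + σ₂ ^ 2)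
    (γinf : ℝ)
    (hγinf : γinf = -lam * σ₁ ^ 2 + Real.sqrt (lam ^ 2 * σ₁ ^ 4 + σ₁ ^ 2 * σ₂ ^ 2))
    (hγmax : γinf < γmax)
    (c c' : ℝ → ℝ)
    (hc_nonneg : ∀ x : ℝ, 0 ≤ x → 0 ≤ c x)
    (hc_conv : StrictConvexOn ℝ (Set.Ici 0) c)
    (hc_mono : StrictMonoOn c (Set.Ici 0))
    (hc_smooth : ContDiffOn ℝ 2 c (Set.Ici 0))
    (hc_deriv : ∀ x ∈ Set.Ici (0 : ℝ), HasDerivWithinAt c (c' x) (Set.Ici 0) x)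
    (hhmax : 0 < hmax) (hc_hmax : c' hmax = γmax ^ 2 * (abar / δ))
    (Adm : (ℝ → ℝ) → Prop)
    (hAdm : ∀ h : ℝ → ℝ, Adm h ↔ Measurable h ∧ ∀ t : ℝ, h t ∈ Set.Icc 0 hmax)
    (sol : (ℝ → ℝ) → ℝ → ℝ → ℝ)
    (hsol : ∀ h : ℝ → ℝ, Adm h → ∀ γ₀ ∈ Set.Icc (0 : ℝ) γmax,
      sol h γ₀ 0 = γ₀ ∧
      ContinuousOn (sol h γ₀) (Set.Ici 0) ∧
      (∀ t ∈ Set.Ici (0 : ℝ), sol h γ₀ t ∈ Set.Icc 0 γmax) ∧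
      (∀ t ∈ Set.Ici (0 : ℝ),
        sol h γ₀ t = γ₀ + ∫ s in (0 : ℝ)..t, f (sol h γ₀ s) (h s)))
    (J : (ℝ → ℝ) → ℝ → ℝ)
    (hJ : ∀ (h : ℝ → ℝ) (γ₀ : ℝ), J h γ₀ =
      ∫ t in Set.Ioi (0 : ℝ), Real.exp (-δ * t) * (abar * sol h γ₀ t + c (h t)))
    (v : ℝ → ℝ)
    (hv : ∀ γ₀ ∈ Set.Icc (0 : ℝ) γmax,
      v γ₀ = sInf ((fun h => J h γ₀) '' {h : ℝ → ℝ | Adm h}))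
    (v' : ℝ → ℝ)
    (hv_conc : ConcaveOn ℝ (Set.Icc 0 γmax) v)
    (hv'_deriv : ∀ x ∈ Set.Ioo (0 : ℝ) γmax, HasDerivAt v (v' x) x)
    (hv'_cont : ContinuousOn v' (Set.Ioo 0 γmax))
    (hv'_zero : HasDerivWithinAt v (v' 0) (Set.Icc 0 γmax) 0)
    (hv'_gmax : HasDerivWithinAt v (v' γmax) (Set.Icc 0 γmax) γmax)
    (Hstar : ℝ → ℝ)
    (hHstar : ∀ γ ∈ Set.Icc (0 : ℝ) γmax,
      (γ ^ 2 * v' γ < c' 0 → Hstar γ = 0) ∧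
      (c' 0 ≤ γ ^ 2 * v' γ →
        Hstar γ ∈ Set.Icc (0 : ℝ) hmax ∧ c' (Hstar γ) = γ ^ 2 * v' γ))
    (γeq : ℝ) (hγeq_mem : γeq ∈ Set.Icc (0 : ℝ) γinf)
    (hγeq_zero : f γeq (Hstar γeq) = 0)
    (hγeq_pos : ∀ γ ∈ Set.Ico (0 : ℝ) γeq, 0 < f γ (Hstar γ))
    (hγeq_neg : ∀ γ ∈ Set.Ioc γeq γmax, f γ (Hstar γ) < 0)
    (γ₀ : ℝ) (hγ₀ : γ₀ ∈ Set.Icc (0 : ℝ) γmax)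
    (γstar : ℝ → ℝ) (hγstar0 : γstar 0 = γ₀)
    (hγstar : ∀ t ∈ Set.Ici (0 : ℝ), γstar t ∈ Set.Icc 0 γmax ∧
      HasDerivWithinAt γstar (f (γstar t) (Hstar (γstar t))) (Set.Ici 0) t) :
    (MonotoneOn γstar (Set.Ici 0) ∨ AntitoneOn γstar (Set.Ici 0)) ∧
    Filter.Tendsto γstar Filter.atTop (nhds γeq) ∧
    (MonotoneOn (fun t => Hstar (γstar t)) (Set.Ici 0) ∨
      AntitoneOn (fun t => Hstar (γstar t)) (Set.Ici 0)) ∧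
    Filter.Tendsto (fun t => Hstar (γstar t)) Filter.atTop (nhds (Hstar γeq)) ∧
    γeq ≤ γinf ∧ (γeq = 0 ↔ σ₂ = 0) := by
  have hγmax0 : 0 < γmax := lt_of_le_of_lt (hγeq_mem.1.trans hγeq_mem.2) hγmax
  have hp : (0:ℝ) < 1 / σ₁ ^ 2 := by positivity
  -- admissible solutions, extended continuously
  have hext : ∀ h, Adm h → ∀ x ∈ Ioc (0:ℝ) γmax, ∃ g : ℝ → ℝ, Continuous g ∧
      (∀ t, 0 ≤ t → g t = sol h x t) ∧ g 0 = x ∧ (∀ t, 0 < g t) ∧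
      (∀ t, 0 ≤ t → g t = g 0 + ∫ s in (0:ℝ)..t,
        (-(1 / σ₁ ^ 2 + h s) * g s ^ 2 - 2 * lam * g s + σ₂ ^ 2)) := by
    intro h hh x hx
    obtain ⟨s0, s1, s2, s3⟩ := hsol h hh x ⟨hx.1.le, hx.2⟩
    obtain ⟨hm, hb⟩ := (hAdm h).1 hh
    set g : ℝ → ℝ := fun t => sol h x (max t 0) with hg
    have gc : Continuous g := by
      refine s1.comp_continuous (by fun_prop) fun t => mem_Ici.2 (le_max_right _ _)
    have ge : ∀ t, 0 ≤ t → g t = sol h x t := fun t ht => by simp only [hg, max_eq_left ht]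
    have g0 : g 0 = x := by rw [ge 0 le_rfl, s0]
    have geq : ∀ t, 0 ≤ t → g t = g 0 + ∫ s in (0:ℝ)..t,
        (-(1 / σ₁ ^ 2 + h s) * g s ^ 2 - 2 * lam * g s + σ₂ ^ 2) := by
      intro t ht
      rw [ge t ht, g0, s3 t ht]
      congr 1
      refine intervalIntegral.integral_congr fun s hs => ?_
      rw [uIcc_of_le ht] at hs
      simp only [hf, ge s hs.1]
    have gb : ∀ t, g t ∈ Icc 0 γmax := fun t => s2 _ (le_max_right t 0)
    have gp : ∀ t, 0 ≤ t → 0 < g t := fun t ht =>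
      sol_pos hp.le hlam (sq_nonneg σ₂) gc hm hb gb (by rw [g0]; exact hx.1) geq ht
    refine ⟨g, gc, ge, g0, fun t => ?_, geq⟩
    have := gp (max t 0) (le_max_right _ _)
    simpa [hg] using this
  have hJnn : ∀ h, Adm h → ∀ x ∈ Icc (0:ℝ) γmax, 0 ≤ J h x := by
    intro h hh x hx
    rw [hJ]
    refine setIntegral_nonneg measurableSet_Ioi fun t ht => ?_
    have a1 := (hsol h hh x hx).2.2.1 t (Ioi_subset_Ici_self ht)
    have a2 := hc_nonneg _ (((hAdm h).1 hh).2 t).1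
    have := a1.1
    positivity
  have hbdd : ∀ x ∈ Icc (0:ℝ) γmax, BddBelow ((fun h => J h x) '' {h : ℝ → ℝ | Adm h}) := by
    intro x hx
    refine ⟨0, ?_⟩
    rintro _ ⟨h, hh, rfl⟩
    exact hJnn h hh x hx
  have hne : ∀ x, ((fun h => J h x) '' {h : ℝ → ℝ | Adm h}).Nonempty := fun x =>
    ⟨_, fun _ => 0, (hAdm _).2 ⟨measurable_const, fun _ => ⟨le_rfl, hhmax.le⟩⟩, rfl⟩
  have hconv : ∀ x₁ ∈ Ioc (0:ℝ) γmax, ∀ x₂ ∈ Ioc (0:ℝ) γmax, ∀ x ∈ Ioc (0:ℝ) γmax,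
      ∀ a b : ℝ, 0 ≤ a → 0 ≤ b → a + b = 1 → 1 / x = a * (1 / x₁) + b * (1 / x₂) →
      v x ≤ a * v x₁ + b * v x₂ := by
    intro x₁ hx₁ x₂ hx₂ x hx a b ha hb hab hxe
    have m : ∀ {y}, y ∈ Ioc (0:ℝ) γmax → y ∈ Icc (0:ℝ) γmax := fun hy => ⟨hy.1.le, hy.2⟩
    refine le_of_forall_pos_le_add fun ε hε => ?_
    obtain ⟨_, ⟨h₁, hh₁, rfl⟩, hl₁⟩ := exists_lt_of_csInf_lt (hne x₁)
      (show _ < v x₁ + ε by rw [← hv x₁ (m hx₁)]; linarith)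
    obtain ⟨_, ⟨h₂, hh₂, rfl⟩, hl₂⟩ := exists_lt_of_csInf_lt (hne x₂)
      (show _ < v x₂ + ε by rw [← hv x₂ (m hx₂)]; linarith)
    simp only at hl₁ hl₂
    have hh₁ : Adm h₁ := hh₁
    have hh₂ : Adm h₂ := hh₂
    obtain ⟨mh₁, bh₁⟩ := (hAdm _).1 hh₁
    obtain ⟨mh₂, bh₂⟩ := (hAdm _).1 hh₂
    set h : ℝ → ℝ := fun t => a * h₁ t + b * h₂ t with hdef
    have mh : Measurable h := by fun_prop
    have bh : ∀ t, h t ∈ Icc 0 hmax := fun t =>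
      (convex_Icc 0 hmax) (bh₁ t) (bh₂ t) ha hb hab
    have hh : Adm h := (hAdm _).2 ⟨mh, bh⟩
    obtain ⟨g, gc, ge, g0, gp, geq⟩ := hext h hh x hx
    obtain ⟨g₁, gc₁, ge₁, g0₁, gp₁, geq₁⟩ := hext h₁ hh₁ x₁ hx₁
    obtain ⟨g₂, gc₂, ge₂, g0₂, gp₂, geq₂⟩ := hext h₂ hh₂ x₂ hx₂
    have hcmp : ∀ t, 0 ≤ t → sol h x t ≤ a * sol h₁ x₁ t + b * sol h₂ x₂ t := by
      intro t ht
      rw [← ge t ht, ← ge₁ t ht, ← ge₂ t ht]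
      refine harm_le ha hb hab (gp₁ t) (gp₂ t) (gp t) ?_
      exact recip_compare (sq_nonneg σ₂) ha hb hab gc gc₁ gc₂ mh mh₁ mh₂ bh bh₁ bh₂ gp gp₁ gp₂
        geq geq₁ geq₂ (fun _ => rfl) (by rw [g0, g0₁, g0₂]; exact hxe) ht
    have hI : ∀ h, Adm h → ∀ y ∈ Ioc (0:ℝ) γmax, IntegrableOn
        (fun t => Real.exp (-δ * t) * (abar * sol h y t + c (h t))) (Ioi 0) := by
      intro h hh y hy
      have := hsol h hh y (m hy)
      exact cost_integrable hδ habar hc_nonneg hc_mono this.2.1 this.2.2.1 ((hAdm _).1 hh).1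
        ((hAdm _).1 hh).2
    have hJle : J h x ≤ a * J h₁ x₁ + b * J h₂ x₂ := by
      rw [hJ, hJ, hJ, ← integral_const_mul, ← integral_const_mul,
        ← integral_add ((hI h₁ hh₁ x₁ hx₁).const_mul _) ((hI h₂ hh₂ x₂ hx₂).const_mul _)]
      refine setIntegral_mono_on (hI h hh x hx)
        (((hI h₁ hh₁ x₁ hx₁).const_mul _).add ((hI h₂ hh₂ x₂ hx₂).const_mul _))
        measurableSet_Ioi fun t ht => ?_
      have e := Real.exp_pos (-δ * t)
      have c1 := mul_le_mul_of_nonneg_left (hcmp t (le_of_lt ht)) habar.le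
      have c2 : c (h t) ≤ a * c (h₁ t) + b * c (h₂ t) :=
        hc_conv.convexOn.2 (bh₁ t).1 (bh₂ t).1 ha hb hab
      have c3 : abar * sol h x t + c (h t) ≤ a * (abar * sol h₁ x₁ t + c (h₁ t))
        + b * (abar * sol h₂ x₂ t + c (h₂ t)) := by linarith
      have c4 := mul_le_mul_of_nonneg_left c3 e.le
      linarith
    have hvle : v x ≤ J h x := by
      rw [hv x (m hx)]
      exact csInf_le (hbdd x (m hx)) ⟨h, hh, rfl⟩
    have d1 := mul_le_mul_of_nonneg_left hl₁.le ha
    have d2 := mul_le_mul_of_nonneg_left hl₂.le hb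
    have d3 : a * (v x₁ + ε) + b * (v x₂ + ε) = a * v x₁ + b * v x₂ + (a + b) * ε := by ring
    rw [hab] at d3
    linarith
  have hvd : ∀ x ∈ Ioc (0:ℝ) γmax, HasDerivWithinAt v (v' x) (Icc 0 γmax) x := by
    intro x hx
    rcases hx.2.eq_or_lt with h | h
    · rw [h]; exact hv'_gmax
    · exact (hv'_deriv x ⟨hx.1, h⟩).hasDerivWithinAt
  set Q : ℝ → ℝ := fun x => x ^ 2 * v' x with hQ
  have hQmono : ∀ x ∈ Ioc (0:ℝ) γmax, ∀ y ∈ Ioc (0:ℝ) γmax, x < y → Q x ≤ Q y := by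
    intro x hx y hy hxy
    have him : ∀ z, 1 / γmax ≤ z → 1 / z ∈ Ioc 0 γmax := by
      intro z hz
      have hz0 : 0 < z := lt_of_lt_of_le (by positivity) hz
      refine ⟨by positivity, ?_⟩
      rw [div_le_iff₀ hz0]
      rw [div_le_iff₀ hγmax0] at hz
      linarith
    have hVc : ConvexOn ℝ (Ici (1 / γmax)) (fun z => v (1 / z)) := by
      refine ⟨convex_Ici _, fun z₁ hz₁ z₂ hz₂ a b ha hb hab => ?_⟩
      have hz := convex_Ici (1 / γmax) hz₁ hz₂ ha hb hab
      refine hconv _ (him _ hz₁) _ (him _ hz₂) _ (him _ hz) a b ha hb hab ?_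
      simp
    have hVd : ∀ w ∈ Ioc (0:ℝ) γmax, HasDerivWithinAt (fun z => v (1 / z)) (- Q w)
        (Ici (1 / γmax)) (1 / w) := by
      intro w hw
      have hw0 : (1 / w) ≠ 0 := (one_div_pos.2 hw.1).ne'
      have h1 : HasDerivWithinAt v (v' w) (Icc 0 γmax) ((1 / w)⁻¹) := by
        simpa using hvd w hw
      have h2 := h1.comp (1 / w) ((hasDerivAt_inv hw0).hasDerivWithinAt (s := Ici (1 / γmax)))
        (fun z hz => by
          have := him z hz
          rw [one_div] at this
          exact ⟨this.1.le, this.2⟩)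
      have e1 : v' w * -((1 / w) ^ 2)⁻¹ = - Q w := by
        simp only [hQ]; simp; ring
      rw [e1] at h2
      refine h2.congr_of_eventuallyEq (Eventually.of_forall fun z => ?_) ?_ <;> simp
    have hmem : ∀ w ∈ Ioc (0:ℝ) γmax, 1 / w ∈ Ici (1 / γmax) := fun w hw =>
      one_div_le_one_div_of_le hw.1 hw.2
    have hlt : 1 / y < 1 / x := one_div_lt_one_div_of_lt hx.1 hxy
    have i1 := hVc.le_slope_of_hasDerivWithinAt (hmem y hy) (hmem x hx) hlt (hVd y hy)
    have i2 := hVc.slope_le_of_hasDerivWithinAt (hmem y hy) (hmem x hx) hlt (hVd x hx)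
    linarith
  -- c'
  have hc'mono : StrictMonoOn c' (Ici 0) := by
    intro x hx y hy hxy
    have i1 := hc_conv.lt_slope_of_hasDerivWithinAt hx hy hxy (hc_deriv x hx)
    have i2 := hc_conv.slope_lt_of_hasDerivWithinAt hx hy hxy (hc_deriv y hy)
    linarith
  have hc'0 : 0 ≤ c' 0 := by
    have h1 := (hc_deriv 0 self_mem_Ici)
    have h2 := hc_mono.monotoneOn.derivWithin_nonneg (x := 0)
    rwa [h1.derivWithin (uniqueDiffOn_Ici 0 0 self_mem_Ici)] at h2
  have hHnn : ∀ x ∈ Icc (0:ℝ) γmax, 0 ≤ Hstar x := by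
    intro x hx
    rcases lt_or_ge (x ^ 2 * v' x) (c' 0) with h | h
    · rw [(hHstar x hx).1 h]
    · exact ((hHstar x hx).2 h).1.1
  have hH0 : Hstar 0 = 0 := by
    have h0 : (0:ℝ) ∈ Icc 0 γmax := ⟨le_rfl, hγmax0.le⟩
    rcases lt_or_ge ((0:ℝ) ^ 2 * v' 0) (c' 0) with h | h
    · exact (hHstar 0 h0).1 h
    · obtain ⟨h1, h2⟩ := (hHstar 0 h0).2 h
      refine hc'mono.injOn h1.1 (self_mem_Ici (a := (0:ℝ))) ?_
      rw [h2]
      refine le_antisymm ?_ h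
      simpa using hc'0
  have hHmono : MonotoneOn Hstar (Icc 0 γmax) := by
    intro x hx y hy hxy
    rcases hx.1.eq_or_lt with h0 | h0
    · rw [← h0, hH0]; exact hHnn y hy
    rcases hxy.eq_or_lt with h1 | h1
    · rw [h1]
    have hq := hQmono x ⟨h0, hx.2⟩ y ⟨h0.trans h1, hy.2⟩ h1
    simp only [hQ] at hq
    rcases lt_or_ge (x ^ 2 * v' x) (c' 0) with h | h
    · rw [(hHstar x hx).1 h]; exact hHnn y hy
    · obtain ⟨a1, a2⟩ := (hHstar x hx).2 h
      obtain ⟨b1, b2⟩ := (hHstar y hy).2 (h.trans hq)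
      rw [← hc'mono.le_iff_le a1.1 b1.1, a2, b2]
      exact hq
  -- the feedback vector field is antitone
  have hGanti : ∀ x ∈ Icc (0:ℝ) γmax, ∀ y ∈ Icc (0:ℝ) γmax, x ≤ y →
      f y (Hstar y) ≤ f x (Hstar x) := by
    intro x hx y hy hxy
    rw [hf, hf]
    have a1 := hHmono hx hy hxy
    have a2 := hHnn x hx
    have a3 : x ^ 2 ≤ y ^ 2 := pow_le_pow_left₀ hx.1 hxy 2
    have a4 : (1 / σ₁ ^ 2 + Hstar x) * x ^ 2 ≤ (1 / σ₁ ^ 2 + Hstar y) * y ^ 2 :=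
      mul_le_mul (by linarith) a3 (sq_nonneg _) (by linarith)
    have a5 := mul_le_mul_of_nonneg_left hxy hlam
    linarith
  have hγeqm : γeq < γmax := lt_of_le_of_lt hγeq_mem.2 hγmax
  have hγeqI : γeq ∈ Icc (0:ℝ) γmax := ⟨hγeq_mem.1, hγeqm.le⟩
  have htraj : (MonotoneOn γstar (Set.Ici 0) ∨ AntitoneOn γstar (Set.Ici 0)) ∧
      Filter.Tendsto γstar Filter.atTop (nhds γeq) := by
    rcases le_total γeq (γstar 0) with h | h
    · have := traj_right (a := 0) (b := γmax) (G := fun y => f y (Hstar y)) hγstar hγeq_zero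
        hγeq_pos hγeq_neg (fun L hL y hy => hGanti L ⟨hγeq_mem.1.trans hL.1.le, hL.2⟩ y
          ⟨(hγeq_mem.1.trans hL.1.le).trans hy.1, hy.2⟩ hy.1) h
      exact ⟨Or.inr this.1, this.2⟩
    · have := traj_left (a := 0) (b := γmax) (G := fun y => f y (Hstar y)) hγstar hγeq_zero
        hγeq_pos hγeq_neg (fun L hL y hy => hGanti y
          ⟨hy.1, hy.2.trans (hL.2.le.trans hγeqm.le)⟩ L ⟨hL.1, hL.2.le.trans hγeqm.le⟩ hy.2) h
      exact ⟨Or.inl this.1, this.2⟩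
  obtain ⟨hmon, hlim⟩ := htraj
  have hin : ∀ t ∈ Ici (0:ℝ), γstar t ∈ Icc 0 γmax := fun t ht => (hγstar t ht).1
  -- upper and lower limits of Q at the equilibrium
  have hQup : ∀ r, Q γeq < r → ∀ᶠ x in 𝓝[Icc 0 γmax] γeq, Q x < r := by
    intro r hr
    rcases hγeq_mem.1.eq_or_lt with h0 | h0
    · rw [← h0] at hr ⊢
      have hr' : 0 < r := by simpa [hQ] using hr
      have ht : Tendsto (fun x : ℝ => x ^ 2 * v' 0) (𝓝[Icc 0 γmax] 0) (𝓝 0) := by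
        have : Continuous fun x : ℝ => x ^ 2 * v' 0 := by fun_prop
        simpa using (this.tendsto 0).mono_left nhdsWithin_le_nhds
      filter_upwards [ht.eventually_lt_const hr', self_mem_nhdsWithin] with x hx hxI
      refine lt_of_le_of_lt ?_ hx
      rcases hxI.1.eq_or_lt with hx0 | hx0
      · simp only [hQ, ← hx0]; simp
      · have z : (0:ℝ) ∈ Icc 0 γmax := ⟨le_rfl, hγmax0.le⟩
        have i1 := hv_conc.slope_le_of_hasDerivWithinAt z hxI hx0 hv'_zero
        have i2 := hv_conc.le_slope_of_hasDerivWithinAt z hxI hx0 (hvd x ⟨hx0, hxI.2⟩)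
        exact mul_le_mul_of_nonneg_left (i2.trans i1) (sq_nonneg x)
    · have hc : ContinuousAt Q γeq :=
        (continuous_pow 2).continuousAt.mul
          (hv'_cont.continuousAt (Ioo_mem_nhds h0 hγeqm))
      exact (hc.eventually_lt_const hr).filter_mono nhdsWithin_le_nhds
  have hQlow : 0 < γeq → ∀ r, r < Q γeq → ∀ᶠ x in 𝓝[Icc 0 γmax] γeq, r < Q x := by
    intro h0 r hr
    have hc : ContinuousAt Q γeq :=
      (continuous_pow 2).continuousAt.mul
        (hv'_cont.continuousAt (Ioo_mem_nhds h0 hγeqm))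
    exact (hc.eventually_const_lt hr).filter_mono nhdsWithin_le_nhds
  have hHcont : Tendsto Hstar (𝓝[Icc 0 γmax] γeq) (𝓝 (Hstar γeq)) := by
    have hn := hHnn γeq hγeqI
    rw [tendsto_order]
    constructor
    · intro r hr
      rcases lt_or_ge r 0 with hr0 | hr0
      · filter_upwards [self_mem_nhdsWithin] with x hx
        exact hr0.trans_le (hHnn x hx)
      · have hpos : 0 < γeq := by
          refine lt_of_le_of_ne hγeq_mem.1 fun h => ?_
          rw [← h, hH0] at hr
          linarith
        have hge : c' 0 ≤ γeq ^ 2 * v' γeq := by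
          by_contra hcon
          rw [(hHstar γeq hγeqI).1 (not_le.1 hcon)] at hr
          linarith
        have hq : c' r < Q γeq := by
          simp only [hQ]
          rw [← ((hHstar γeq hγeqI).2 hge).2]
          exact hc'mono hr0 hn hr
        filter_upwards [hQlow hpos _ hq, self_mem_nhdsWithin] with x hx hxI
        have h1 : c' 0 ≤ c' r := hc'mono.monotoneOn self_mem_Ici hr0 hr0
        obtain ⟨b1, b2⟩ := (hHstar x hxI).2 (h1.trans hx.le)
        rw [← hc'mono.lt_iff_lt hr0 b1.1, b2]
        exact hx
    · intro r hr
      have hr0 : 0 < r := hn.trans_lt hr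
      have hq : Q γeq < c' r := by
        rcases lt_or_ge (γeq ^ 2 * v' γeq) (c' 0) with h | h
        · exact lt_trans h (hc'mono self_mem_Ici hr0.le hr0)
        · simp only [hQ]
          rw [← ((hHstar γeq hγeqI).2 h).2]
          exact hc'mono hn hr0.le hr
      filter_upwards [hQup _ hq, self_mem_nhdsWithin] with x hx hxI
      rcases lt_or_ge (x ^ 2 * v' x) (c' 0) with h | h
      · rw [(hHstar x hxI).1 h]; exact hr0
      · obtain ⟨b1, b2⟩ := (hHstar x hxI).2 h
        rw [← hc'mono.lt_iff_lt b1.1 hr0.le, b2]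
        exact hx
  refine ⟨hmon, hlim, ?_, ?_, hγeq_mem.2, ?_⟩
  · rcases hmon with h | h
    · exact Or.inl fun s hs t ht hst => hHmono (hin s hs) (hin t ht) (h hs ht hst)
    · exact Or.inr fun s hs t ht hst => hHmono (hin t ht) (hin s hs) (h hs ht hst)
  · refine hHcont.comp (tendsto_nhdsWithin_iff.2 ⟨hlim, ?_⟩)
    filter_upwards [eventually_ge_atTop (0:ℝ)] with t ht
    exact hin t ht
  · have hz := hγeq_zero
    rw [hf] at hz
    have hn := hHnn γeq hγeqI
    constructor
    · intro h
      rw [h] at hz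
      simpa using hz
    · intro h
      rw [h] at hz
      by_contra hne0
      have hpos : 0 < γeq := lt_of_le_of_ne hγeq_mem.1 (Ne.symm hne0)
      have : 0 < (1 / σ₁ ^ 2 + Hstar γeq) * γeq ^ 2 := by positivity
      have : 0 ≤ lam * γeq := by positivity
      nlinarith
end

section
/- At the equilibrium γ_eq, the value function satisfies v(γ_eq) = (ā·γ_eq + c(h_eq))/δ, where h_eq := H*(γ_eq). Furthermore: if γ_eq ∈ [0, γ_D] then h_eq = 0, and if additionally γ_eq ∈ (0, γ_D), then v'(γ_eq) = ā/(2σ̄₁²·γ_eq + 2λ + δ); conversely, if γ_eq ∈ (γ_D, γ_max], then h_eq = −(2λ·γ_eq − σ₂²)/γ_eq² − σ̄₁² and v'(γ_eq) = c'(h_eq)/γ_eq². -/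
open MeasureTheory Set Filter Topology

lemma aux_intervalIntegrable {G : ℝ → ℝ} {M : ℝ}
    (hm : AEMeasurable G (volume.restrict (Ioi (0 : ℝ)))) (hb : ∀ s, 0 ≤ s → |G s| ≤ M)
    {a b : ℝ} (ha : 0 ≤ a) (hab : a ≤ b) : IntervalIntegrable G volume a b := by
  rw [intervalIntegrable_iff_integrableOn_Ioc_of_le hab]
  have hsub : Ioc a b ⊆ Ioi (0 : ℝ) := fun x hx => lt_of_le_of_lt ha hx.1
  refine Integrable.of_bound (C := M) ?_ ?_
  · exact (hm.mono_measure (Measure.restrict_mono hsub le_rfl)).aestronglyMeasurable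
  · refine (ae_restrict_iff' measurableSet_Ioc).2 (ae_of_all _ fun x hx => ?_)
    exact hb x (hsub hx).le

lemma aux_integrableOn_exp {G : ℝ → ℝ} {M δ : ℝ} (hδ : 0 < δ)
    (hm : AEMeasurable G (volume.restrict (Ioi (0 : ℝ)))) (hb : ∀ s, 0 ≤ s → |G s| ≤ M) :
    IntegrableOn (fun t => Real.exp (-δ * t) * G t) (Ioi 0) := by
  have h1 : IntegrableOn (fun t => Real.exp (-δ * t)) (Ioi 0) :=
    integrableOn_exp_mul_Ioi (by linarith) 0
  refine Integrable.mul_bdd (c := M) h1 hm.aestronglyMeasurable ?_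
  refine (ae_restrict_iff' measurableSet_Ioi).2 (ae_of_all _ fun x hx => ?_)
  exact hb x (le_of_lt hx)

lemma aux_uniq {x y : ℝ → ℝ} {Fx Fy : ℝ → ℝ} {x0 K : ℝ}
    (hx : ContinuousOn x (Ici 0)) (hy : ContinuousOn y (Ici 0))
    (hFx : ∀ t, 0 ≤ t → IntervalIntegrable Fx volume 0 t)
    (hFy : ∀ t, 0 ≤ t → IntervalIntegrable Fy volume 0 t)
    (hK : ∀ s, 0 ≤ s → |Fx s - Fy s| ≤ K * |x s - y s|)
    (ex : ∀ t, 0 ≤ t → x t = x0 + ∫ s in (0:ℝ)..t, Fx s)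
    (ey : ∀ t, 0 ≤ t → y t = x0 + ∫ s in (0:ℝ)..t, Fy s) :
    ∀ t, 0 ≤ t → x t = y t := by
  set z : ℝ → ℝ := fun s => |x (max s 0) - y (max s 0)| with hz
  have hzx : ∀ s, 0 ≤ s → z s = |x s - y s| := fun s hs => by simp [hz, max_eq_left hs]
  have hzc : Continuous z := by
    have h1 : Continuous fun s : ℝ => x (max s 0) :=
      hx.comp_continuous (by fun_prop) (fun s => by simp)
    have h2 : Continuous fun s : ℝ => y (max s 0) :=
      hy.comp_continuous (by fun_prop) (fun s => by simp)
    exact (h1.sub h2).abs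
  have hUd : ∀ t, HasDerivAt (fun t => ∫ s in (0:ℝ)..t, z s) (z t) t := fun t =>
    intervalIntegral.integral_hasDerivAt_right (hzc.intervalIntegrable _ _)
      (hzc.stronglyMeasurableAtFilter _ _) hzc.continuousAt
  have hUnn : ∀ t, 0 ≤ t → 0 ≤ ∫ s in (0:ℝ)..t, z s := fun t ht =>
    intervalIntegral.integral_nonneg ht (fun s _ => abs_nonneg _)
  have key : ∀ t, 0 ≤ t → z t ≤ K * ∫ s in (0:ℝ)..t, z s := by
    intro t ht
    rw [hzx t ht, ex t ht, ey t ht, add_sub_add_left_eq_sub,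
      ← intervalIntegral.integral_sub (hFx t ht) (hFy t ht),
      ← intervalIntegral.integral_const_mul]
    refine (intervalIntegral.abs_integral_le_integral_abs ht).trans ?_
    refine intervalIntegral.integral_mono_on ht ((hFx t ht).sub (hFy t ht)).abs
      ((hzc.const_mul K).intervalIntegrable _ _) ?_
    intro s hs
    have := hK s hs.1
    simpa only [hzx s hs.1] using this
  intro t ht
  have hU0 : (fun t => ∫ s in (0:ℝ)..t, z s) t = 0 := by
    refine eq_zero_of_abs_deriv_le_mul_abs_self_of_eq_zero_right (K := K) (a := 0) (b := t)
      (f' := z) (fun u _ => (hUd u).continuousAt.continuousWithinAt)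
      (fun u _ => (hUd u).hasDerivWithinAt) (by simp) ?_ t ⟨ht, le_rfl⟩
    intro u hu
    rw [Real.norm_of_nonneg (hUnn u hu.1), Real.norm_of_nonneg (abs_nonneg _)]
    exact key u hu.1
  have h3 := key t ht
  simp only at hU0
  rw [hU0, mul_zero, hzx t ht] at h3
  have := abs_nonpos_iff.1 h3
  linarith

lemma aux_tangent {c c' : ℝ → ℝ} (hc_conv : StrictConvexOn ℝ (Ici 0) c)
    (hc_deriv : ∀ x ∈ Ici (0 : ℝ), HasDerivWithinAt c (c' x) (Ici 0) x)
    {a b : ℝ} (ha : 0 ≤ a) (hb : 0 ≤ b) : c a + c' a * (b - a) ≤ c b := by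
  rcases lt_trichotomy a b with h | h | h
  · have := hc_conv.convexOn.le_slope_of_hasDerivWithinAt ha hb h (hc_deriv a ha)
    rw [slope_def_field, le_div_iff₀ (by linarith)] at this
    linarith
  · subst h; simp
  · have := hc_conv.convexOn.slope_le_of_hasDerivWithinAt hb ha h (hc_deriv a ha)
    rw [slope_def_field, div_le_iff₀ (by linarith)] at this
    linarith

lemma aux_strict {c c' : ℝ → ℝ} (hc_conv : StrictConvexOn ℝ (Ici 0) c)
    (hc_deriv : ∀ x ∈ Ici (0 : ℝ), HasDerivWithinAt c (c' x) (Ici 0) x)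
    {a : ℝ} (ha : 0 ≤ a) (h : c' a = c' 0) : a = 0 := by
  by_contra hne
  have hpos : 0 < a := lt_of_le_of_ne ha (Ne.symm hne)
  have h1 := hc_conv.lt_slope_of_hasDerivWithinAt (mem_Ici.2 le_rfl) ha hpos (hc_deriv 0 (mem_Ici.2 le_rfl))
  have h2 := hc_conv.slope_lt_of_hasDerivWithinAt (mem_Ici.2 le_rfl) ha hpos (hc_deriv a ha)
  linarith

lemma aux_dpp (δ abar γmax hmax : ℝ) (hδ : 0 < δ) (habar : 0 < abar) 
    (f : ℝ → ℝ → ℝ) (hfc : Continuous (Function.uncurry f)) (K B : ℝ)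
    (hK : ∀ x ∈ Icc 0 γmax, ∀ y ∈ Icc 0 γmax, ∀ h ∈ Icc 0 hmax, |f x h - f y h| ≤ K * |x - y|)
    (hB : ∀ x ∈ Icc 0 γmax, ∀ h ∈ Icc 0 hmax, |f x h| ≤ B)
    (c : ℝ → ℝ) (hc_nonneg : ∀ x : ℝ, 0 ≤ x → 0 ≤ c x)
    (hc_cont : ContinuousOn c (Ici 0)) (hc_mono : StrictMonoOn c (Ici 0))
    (Adm : (ℝ → ℝ) → Prop)
    (hAdm : ∀ h : ℝ → ℝ, Adm h ↔ Measurable h ∧ ∀ t : ℝ, h t ∈ Set.Icc 0 hmax)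
    (sol : (ℝ → ℝ) → ℝ → ℝ → ℝ)
    (hsol : ∀ h : ℝ → ℝ, Adm h → ∀ γ₀ ∈ Set.Icc (0 : ℝ) γmax,
      sol h γ₀ 0 = γ₀ ∧
      ContinuousOn (sol h γ₀) (Set.Ici 0) ∧
      (∀ t ∈ Set.Ici (0 : ℝ), sol h γ₀ t ∈ Set.Icc 0 γmax) ∧
      (∀ t ∈ Set.Ici (0 : ℝ),
        sol h γ₀ t = γ₀ + ∫ s in (0 : ℝ)..t, f (sol h γ₀ s) (h s)))
    (J : (ℝ → ℝ) → ℝ → ℝ)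
    (hJ : ∀ (h : ℝ → ℝ) (γ₀ : ℝ), J h γ₀ =
      ∫ t in Set.Ioi (0 : ℝ), Real.exp (-δ * t) * (abar * sol h γ₀ t + c (h t)))
    (v : ℝ → ℝ)
    (hv : ∀ γ₀ ∈ Set.Icc (0 : ℝ) γmax,
      v γ₀ = sInf ((fun h => J h γ₀) '' {h : ℝ → ℝ | Adm h}))
    (h : ℝ → ℝ) (hh : Adm h) (γ₀ : ℝ) (hγ₀ : γ₀ ∈ Icc 0 γmax) :
    (v γ₀ ≤ J h γ₀) ∧ 0 ≤ v γ₀ ∧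
    (∀ x, ContinuousOn x (Ici 0) → (∀ t, 0 ≤ t → x t ∈ Icc 0 γmax) → 
      (∀ t, 0 ≤ t → x t = γ₀ + ∫ s in (0:ℝ)..t, f (x s) (h s)) → ∀ t, 0 ≤ t → sol h γ₀ t = x t) ∧
    (∀ T, 0 ≤ T → IntervalIntegrable (fun s => f (sol h γ₀ s) (h s)) volume 0 T) ∧
    (∀ T, 0 ≤ T → IntervalIntegrable (fun s => abar * sol h γ₀ s + c (h s)) volume 0 T) ∧
    (∀ T, 0 ≤ T → Real.exp (-δ * T) * 
      ((∫ s in (0:ℝ)..T, (abar * sol h γ₀ s + c (h s))) + v (sol h γ₀ T)) ≤ J h γ₀) := by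
  have hJnn : ∀ h, Adm h → ∀ γ₀ ∈ Icc 0 γmax, 0 ≤ J h γ₀ := by
    intro h hh γ₀ hγ₀
    rw [hJ]
    refine setIntegral_nonneg measurableSet_Ioi fun t ht => ?_
    have h1 := ((hsol h hh γ₀ hγ₀).2.2.1 t (mem_Ici.2 (le_of_lt ht))).1
    have h2 := hc_nonneg _ (((hAdm h).1 hh).2 t).1
    positivity
  have hvJ : ∀ h, Adm h → ∀ γ₀ ∈ Icc 0 γmax, v γ₀ ≤ J h γ₀ := by
    intro h hh γ₀ hγ₀
    rw [hv γ₀ hγ₀]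
    refine csInf_le ⟨0, ?_⟩ ⟨h, hh, rfl⟩
    rintro _ ⟨k, hk, rfl⟩
    exact hJnn k hk γ₀ hγ₀
  have hcm : ∀ h, Adm h → Measurable fun t => c (h t) := by
    intro h hh
    have hc2 : Continuous fun s : ℝ => c (max s 0) :=
      hc_cont.comp_continuous (by fun_prop) (fun s => by simp)
    have := hc2.measurable.comp ((hAdm h).1 hh).1
    convert this using 1
    ext t
    simp [max_eq_left (((hAdm h).1 hh).2 t).1]
  have hfI : ∀ h, Adm h → ∀ x, ContinuousOn x (Ici 0) → (∀ t, 0 ≤ t → x t ∈ Icc 0 γmax) → 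
      ∀ a, 0 ≤ a → ∀ T, a ≤ T → IntervalIntegrable (fun s => f (x s) (h s)) volume a T := by
    intro h hh x hx hxm a ha T hT
    refine aux_intervalIntegrable (M := B) ?_ (fun s hs => hB _ (hxm s hs) _ (((hAdm h).1 hh).2 s)) ha hT
    have hxa : AEMeasurable x (volume.restrict (Ioi (0:ℝ))) :=
      (hx.mono Ioi_subset_Ici_self).aemeasurable measurableSet_Ioi
    exact hfc.measurable.comp_aemeasurable (hxa.prodMk ((hAdm h).1 hh).1.aemeasurable)
  have huniq : ∀ h, Adm h → ∀ γ₀ ∈ Icc 0 γmax, 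
      (∀ x, ContinuousOn x (Ici 0) → (∀ t, 0 ≤ t → x t ∈ Icc 0 γmax) → 
      (∀ t, 0 ≤ t → x t = γ₀ + ∫ s in (0:ℝ)..t, f (x s) (h s)) → ∀ t, 0 ≤ t → sol h γ₀ t = x t) := by
    intro h hh γ₀ hγ₀ x hx hxm hxe
    obtain ⟨-, s1, s2, s3⟩ := hsol h hh γ₀ hγ₀
    refine aux_uniq (K := K) s1 hx (hfI h hh _ s1 s2 0 le_rfl) (hfI h hh _ hx hxm 0 le_rfl) ?_ s3 hxe
    intro s hs
    exact hK _ (s2 s hs) _ (hxm s hs) _ (((hAdm h).1 hh).2 s)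
  obtain ⟨s0, s1, s2, s3⟩ := hsol h hh γ₀ hγ₀
  have hhb := ((hAdm h).1 hh).2
  have hlm : AEMeasurable (fun s => abar * sol h γ₀ s + c (h s)) (volume.restrict (Ioi (0:ℝ))) := by
    have hxa : AEMeasurable (sol h γ₀) (volume.restrict (Ioi (0:ℝ))) :=
      (s1.mono Ioi_subset_Ici_self).aemeasurable measurableSet_Ioi
    exact (hxa.const_mul _).add (hcm h hh).aemeasurable
  have hlnn : ∀ s, 0 ≤ s → 0 ≤ abar * sol h γ₀ s + c (h s) := by
    intro s hs
    have h1 := (s2 s hs).1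
    have h2 := hc_nonneg _ (hhb s).1
    positivity
  have hlb : ∀ s, 0 ≤ s → |abar * sol h γ₀ s + c (h s)| ≤ abar * γmax + c hmax := by
    intro s hs
    rw [abs_of_nonneg (hlnn s hs)]
    have h1 := (s2 s hs).2
    have h2 := hc_mono.monotoneOn (hhb s).1 ((hhb s).1.trans (hhb s).2) (hhb s).2
    gcongr
  refine ⟨hvJ h hh γ₀ hγ₀, ?_, huniq h hh γ₀ hγ₀, hfI h hh _ s1 s2 0 le_rfl, 
    fun T hT => aux_intervalIntegrable hlm hlb le_rfl hT, ?_⟩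
  · rw [hv γ₀ hγ₀]
    refine Real.sInf_nonneg ?_
    rintro _ ⟨k, hk, rfl⟩
    exact hJnn k hk γ₀ hγ₀
  intro T hT
  set k : ℝ → ℝ := fun t => h (t + T) with hk
  have hkA : Adm k := by
    rw [hAdm]
    exact ⟨((hAdm h).1 hh).1.comp (measurable_id.add_const T), fun t => hhb _⟩
  have hshift : ∀ t, 0 ≤ t → sol k (sol h γ₀ T) t = sol h γ₀ (t + T) := by
    refine huniq k hkA _ (s2 T hT) (fun t => sol h γ₀ (t + T)) ?_ ?_ ?_
    · refine s1.comp (by fun_prop) ?_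
      intro t ht
      exact add_nonneg ht hT
    · intro t ht; exact s2 _ (add_nonneg ht hT)
    · intro t ht
      have e1 := s3 (t + T) (add_nonneg ht hT)
      have e2 := s3 T hT
      have e3 := intervalIntegral.integral_add_adjacent_intervals
        (hfI h hh _ s1 s2 0 le_rfl T hT) (hfI h hh _ s1 s2 T hT (t + T) (by linarith))
      have e4 := intervalIntegral.integral_comp_add_right (a := 0) (b := t) (fun s => f (sol h γ₀ s) (h s)) T
      rw [zero_add] at e4
      show sol h γ₀ (t + T) = sol h γ₀ T + ∫ s in (0:ℝ)..t, f (sol h γ₀ (s + T)) (h (s + T))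
      rw [e4]
      linarith
  have hint := aux_integrableOn_exp hδ hlm hlb
  have hJs : J h γ₀ = (∫ t in Ioc 0 T, Real.exp (-δ * t) * (abar * sol h γ₀ t + c (h t))) +
      ∫ t in Ioi T, Real.exp (-δ * t) * (abar * sol h γ₀ t + c (h t)) := by
    rw [hJ, ← Ioc_union_Ioi_eq_Ioi hT]
    refine setIntegral_union (Ioc_disjoint_Ioi le_rfl) measurableSet_Ioi ?_ ?_
    · exact hint.mono_set Ioc_subset_Ioi_self
    · exact hint.mono_set (Ioi_subset_Ioi hT)
  have hJt : ∫ t in Ioi T, Real.exp (-δ * t) * (abar * sol h γ₀ t + c (h t)) =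
      Real.exp (-δ * T) * J k (sol h γ₀ T) := by
    have e := (measurePreserving_add_right volume T).setIntegral_preimage_emb
      (measurableEmbedding_addRight T)
      (fun t => Real.exp (-δ * t) * (abar * sol h γ₀ t + c (h t))) (Ioi T)
    have epre : (fun x : ℝ => x + T) ⁻¹' Ioi T = Ioi 0 := by ext x; simp
    rw [epre] at e
    rw [← e, hJ, ← integral_const_mul]
    refine setIntegral_congr_fun measurableSet_Ioi fun t ht => ?_
    have e1 := hshift t (le_of_lt ht)
    have e2 : Real.exp (-δ * (t + T)) = Real.exp (-δ * T) * Real.exp (-δ * t) := by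
      rw [← Real.exp_add]; ring_nf
    simp only [e1, e2]
    rw [mul_assoc]
  have hge := hvJ k hkA _ (s2 T hT)
  have hfirst : Real.exp (-δ * T) * (∫ s in (0:ℝ)..T, (abar * sol h γ₀ s + c (h s))) ≤
      ∫ t in Ioc 0 T, Real.exp (-δ * t) * (abar * sol h γ₀ t + c (h t)) := by
    rw [← intervalIntegral.integral_of_le hT, ← intervalIntegral.integral_const_mul]
    refine intervalIntegral.integral_mono_on hT 
      ((aux_intervalIntegrable hlm hlb le_rfl hT).const_mul _) ?_ ?_
    · rw [intervalIntegrable_iff_integrableOn_Ioc_of_le hT]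
      exact hint.mono_set Ioc_subset_Ioi_self
    · intro s hs
      refine mul_le_mul_of_nonneg_right ?_ (hlnn s hs.1)
      apply Real.exp_le_exp.2
      nlinarith [hs.2]
  rw [hJs, hJt, mul_add]
  exact add_le_add hfirst (mul_le_mul_of_nonneg_left hge (Real.exp_pos _).le)

lemma aux_super (δ abar γmax hmax : ℝ) (hδ : 0 < δ) (habar : 0 < abar) 
    (f : ℝ → ℝ → ℝ) (hfc : Continuous (Function.uncurry f)) (K B : ℝ)
    (hK : ∀ x ∈ Icc 0 γmax, ∀ y ∈ Icc 0 γmax, ∀ h ∈ Icc 0 hmax, |f x h - f y h| ≤ K * |x - y|)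
    (hB : ∀ x ∈ Icc 0 γmax, ∀ h ∈ Icc 0 hmax, |f x h| ≤ B)
    (c : ℝ → ℝ) (hc_nonneg : ∀ x : ℝ, 0 ≤ x → 0 ≤ c x)
    (hc_cont : ContinuousOn c (Ici 0)) (hc_mono : StrictMonoOn c (Ici 0))
    (Adm : (ℝ → ℝ) → Prop)
    (hAdm : ∀ h : ℝ → ℝ, Adm h ↔ Measurable h ∧ ∀ t : ℝ, h t ∈ Set.Icc 0 hmax)
    (sol : (ℝ → ℝ) → ℝ → ℝ → ℝ)
    (hsol : ∀ h : ℝ → ℝ, Adm h → ∀ γ₀ ∈ Set.Icc (0 : ℝ) γmax,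
      sol h γ₀ 0 = γ₀ ∧
      ContinuousOn (sol h γ₀) (Set.Ici 0) ∧
      (∀ t ∈ Set.Ici (0 : ℝ), sol h γ₀ t ∈ Set.Icc 0 γmax) ∧
      (∀ t ∈ Set.Ici (0 : ℝ),
        sol h γ₀ t = γ₀ + ∫ s in (0 : ℝ)..t, f (sol h γ₀ s) (h s)))
    (J : (ℝ → ℝ) → ℝ → ℝ)
    (hJ : ∀ (h : ℝ → ℝ) (γ₀ : ℝ), J h γ₀ =
      ∫ t in Set.Ioi (0 : ℝ), Real.exp (-δ * t) * (abar * sol h γ₀ t + c (h t)))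
    (v : ℝ → ℝ)
    (hv : ∀ γ₀ ∈ Set.Icc (0 : ℝ) γmax,
      v γ₀ = sInf ((fun h => J h γ₀) '' {h : ℝ → ℝ | Adm h}))
    (hhmax : 0 ≤ hmax) (hB0 : 0 ≤ B) (hK0 : 0 ≤ K)
    (γ₀ p A : ℝ) (hγ₀ : γ₀ ∈ Icc 0 γmax) (hp : HasDerivWithinAt v p (Icc 0 γmax) γ₀)
    (hA : ∀ h ∈ Icc 0 hmax, A ≤ abar * γ₀ + c h + p * f γ₀ h) : A ≤ δ * v γ₀ := by
  have D := fun h hh => aux_dpp δ abar γmax hmax hδ habar f hfc K B hK hB c hc_nonneg hc_cont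
    hc_mono Adm hAdm sol hsol J hJ v hv h hh γ₀ hγ₀
  have hadm0 : Adm (fun _ => 0) := (hAdm _).2 ⟨measurable_const, fun _ => ⟨le_rfl, hhmax⟩⟩
  have hv0 : 0 ≤ v γ₀ := (D _ hadm0).2.1
  set C : ℝ := (abar + |p| * K) * B with hC
  have hC0 : 0 ≤ C := by positivity
  -- the one-step estimate
  have step : ∀ ε > 0, ∀ᶠ T in 𝓝[>] (0:ℝ),
      A ≤ (v γ₀ * Real.exp (δ * T) - v γ₀) / T + C * T + ε * B := by
    intro ε hε
    have hlo := (hasDerivWithinAt_iff_isLittleO.1 hp).def hε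
    rw [eventually_nhdsWithin_iff, Metric.eventually_nhds_iff] at hlo
    obtain ⟨η, hη, hlo⟩ := hlo
    have hsmall : ∀ᶠ T in 𝓝[>] (0:ℝ), B * T < η := by
      have : Tendsto (fun T : ℝ => B * T) (𝓝[>] (0:ℝ)) (𝓝 0) := by
        have h1 : Continuous fun T : ℝ => B * T := by fun_prop
        simpa using (h1.tendsto 0).mono_left nhdsWithin_le_nhds
      exact this.eventually_lt_const hη
    filter_upwards [hsmall, self_mem_nhdsWithin] with T hTη hT
    have hT : 0 < T := hT
    have hlow : Real.exp (-δ * T) * (v γ₀ + T * (A - C * T - ε * B)) ≤ v γ₀ := by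
      conv_rhs => rw [hv γ₀ hγ₀]
      refine le_csInf ⟨_, ⟨_, hadm0, rfl⟩⟩ ?_
      rintro _ ⟨h, hh, rfl⟩
      have hh : Adm h := hh
      obtain ⟨-, -, -, d1, d2, d3⟩ := D h hh
      obtain ⟨s0, s1, s2, s3⟩ := hsol h hh γ₀ hγ₀
      have hhb := ((hAdm h).1 hh).2
      refine le_trans ?_ (d3 T hT.le)
      refine mul_le_mul_of_nonneg_left ?_ (Real.exp_pos _).le
      have hdist : ∀ t, 0 ≤ t → |sol h γ₀ t - γ₀| ≤ B * t := by
        intro t ht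
        rw [s3 t ht, add_sub_cancel_left]
        have := intervalIntegral.norm_integral_le_of_norm_le_const (a := 0) (b := t) (C := B)
          (f := fun s => f (sol h γ₀ s) (h s)) ?_
        · simpa [abs_of_nonneg ht] using this
        · intro s hs
          rw [uIoc_of_le ht] at hs
          exact hB _ (s2 s (mem_Ici.2 hs.1.le)) _ (hhb s)
      have hvT : v γ₀ + p * (∫ s in (0:ℝ)..T, f (sol h γ₀ s) (h s)) - ε * (B * T)
          ≤ v (sol h γ₀ T) := by
        have hd := hdist T hT.le
        have h1 := hlo (y := sol h γ₀ T) (by rw [Real.dist_eq]; linarith) (s2 T hT.le)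
        rw [Real.norm_eq_abs, Real.norm_eq_abs, smul_eq_mul] at h1
        have h2 := (abs_le.1 h1).1
        have h3 : ε * |sol h γ₀ T - γ₀| ≤ ε * (B * T) := by gcongr
        have h4 := s3 T hT.le
        have h5 : sol h γ₀ T - γ₀ = ∫ s in (0:ℝ)..T, f (sol h γ₀ s) (h s) := by linarith
        rw [h5] at h2 h3
        linarith
      have hmain : T * (A - C * T) ≤ (∫ s in (0:ℝ)..T, (abar * sol h γ₀ s + c (h s))) +
          p * (∫ s in (0:ℝ)..T, f (sol h γ₀ s) (h s)) := by
        rw [← intervalIntegral.integral_const_mul,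
          ← intervalIntegral.integral_add (d2 T hT.le) ((d1 T hT.le).const_mul p)]
        have e : T * (A - C * T) = ∫ s in (0:ℝ)..T, (A - C * T) := by
          rw [intervalIntegral.integral_const, smul_eq_mul, sub_zero]
        rw [e]
        refine intervalIntegral.integral_mono_on hT.le (by simp)
          ((d2 T hT.le).add ((d1 T hT.le).const_mul p)) ?_
        intro s hs
        have a1 := hA (h s) (hhb s)
        have a2 := hdist s hs.1
        have a3 := hK _ (s2 s hs.1) _ hγ₀ _ (hhb s)
        have a4 : |sol h γ₀ s - γ₀| ≤ B * T := a2.trans (by gcongr; exact hs.2)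
        have a5 : -(|p| * (K * (B * T))) ≤ p * (f (sol h γ₀ s) (h s) - f γ₀ (h s)) := by
          have : |p * (f (sol h γ₀ s) (h s) - f γ₀ (h s))| ≤ |p| * (K * (B * T)) := by
            rw [abs_mul]
            have := a3.trans (mul_le_mul_of_nonneg_left a4 hK0)
            gcongr
          exact (abs_le.1 this).1
        have a6 : -(abar * (B * T)) ≤ abar * (sol h γ₀ s - γ₀) := by
          have := mul_le_mul_of_nonneg_left (abs_le.1 a4).1 habar.le
          linarith
        rw [hC]
        linarith
      linarith
    have hexp : v γ₀ + T * (A - C * T - ε * B) ≤ v γ₀ * Real.exp (δ * T) := by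
      have := mul_le_mul_of_nonneg_right hlow (Real.exp_pos (δ * T)).le
      have e : Real.exp (-δ * T) * Real.exp (δ * T) = 1 := by
        rw [← Real.exp_add]; simp
      calc _ = (Real.exp (-δ * T) * Real.exp (δ * T)) * (v γ₀ + T * (A - C * T - ε * B)) := by
            rw [e, one_mul]
        _ ≤ _ := by linarith
    have : A - C * T - ε * B ≤ (v γ₀ * Real.exp (δ * T) - v γ₀) / T := by
      rw [le_div_iff₀ hT]; linarith
    linarith
  have hlim : Tendsto (fun T : ℝ => (v γ₀ * Real.exp (δ * T) - v γ₀) / T) (𝓝[>] 0)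
      (𝓝 (δ * v γ₀)) := by
    have hd : HasDerivAt (fun T : ℝ => v γ₀ * Real.exp (δ * T)) (v γ₀ * (Real.exp (δ * 0) * (δ * 1))) 0 :=
      (((hasDerivAt_id (0:ℝ)).const_mul δ).exp).const_mul (v γ₀)
    have hd2 := (hasDerivWithinAt_iff_tendsto_slope' (s := Ioi (0:ℝ)) (by simp)).1
      (hd.hasDerivWithinAt (s := Ioi 0))
    have e : v γ₀ * (Real.exp (δ * 0) * (δ * 1)) = δ * v γ₀ := by simp; ring
    rw [e] at hd2
    refine hd2.congr fun T => ?_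
    rw [slope_def_field]; simp
  have hε : ∀ ε > 0, A ≤ δ * v γ₀ + ε * B := by
    intro ε hε
    have hCT : Tendsto (fun T : ℝ => C * T) (𝓝[>] (0:ℝ)) (𝓝 0) := by
      have h1 : Continuous fun T : ℝ => C * T := by fun_prop
      simpa using (h1.tendsto 0).mono_left nhdsWithin_le_nhds
    have := (hlim.add hCT).add_const (ε * B)
    rw [add_zero] at this
    exact ge_of_tendsto this (step ε hε)
  have hlim2 : Tendsto (fun ε : ℝ => δ * v γ₀ + ε * B) (𝓝[>] (0:ℝ)) (𝓝 (δ * v γ₀)) := by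
    have h1 : Continuous fun ε : ℝ => δ * v γ₀ + ε * B := by fun_prop
    simpa using (h1.tendsto 0).mono_left nhdsWithin_le_nhds
  exact ge_of_tendsto hlim2 (by filter_upwards [self_mem_nhdsWithin] with ε h using hε ε h)

/-- At the equilibrium γ_eq the value function satisfies
v(γ_eq) = (ā·γ_eq + c(h_eq))/δ with h_eq = H*(γ_eq). If γ_eq ∈ [0, γ_D] then h_eq = 0,
and if γ_eq ∈ (0, γ_D) then v'(γ_eq) = ā/(2σ̄₁²γ_eq + 2λ + δ); if γ_eq ∈ (γ_D, γ_max]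
then h_eq = −(2λγ_eq − σ₂²)/γ_eq² − σ̄₁² and v'(γ_eq) = c'(h_eq)/γ_eq². -/
theorem stmt_18
    (σ₁ σ₂ lam δ abar γmax hmax : ℝ)
    (hσ₁ : 0 < σ₁) (hσ₂ : 0 ≤ σ₂) (hlam : 0 ≤ lam) (hδ : 0 < δ) (habar : 0 < abar)
    (f : ℝ → ℝ → ℝ)
    (hf : ∀ γ h : ℝ, f γ h = -(1 / σ₁ ^ 2 + h) * γ ^ 2 - 2 * lam * γ + σ₂ ^ 2)
    (γinf : ℝ)
    (hγinf : γinf = -lam * σ₁ ^ 2 + Real.sqrt (lam ^ 2 * σ₁ ^ 4 + σ₁ ^ 2 * σ₂ ^ 2))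
    (hγmax : γinf < γmax)
    (c c' : ℝ → ℝ)
    (hc_nonneg : ∀ x : ℝ, 0 ≤ x → 0 ≤ c x)
    (hc_conv : StrictConvexOn ℝ (Set.Ici 0) c)
    (hc_mono : StrictMonoOn c (Set.Ici 0))
    (hc_smooth : ContDiffOn ℝ 2 c (Set.Ici 0))
    (hc_deriv : ∀ x ∈ Set.Ici (0 : ℝ), HasDerivWithinAt c (c' x) (Set.Ici 0) x)
    (hhmax : 0 < hmax) (hc_hmax : c' hmax = γmax ^ 2 * (abar / δ))
    (Adm : (ℝ → ℝ) → Prop)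
    (hAdm : ∀ h : ℝ → ℝ, Adm h ↔ Measurable h ∧ ∀ t : ℝ, h t ∈ Set.Icc 0 hmax)
    (sol : (ℝ → ℝ) → ℝ → ℝ → ℝ)
    (hsol : ∀ h : ℝ → ℝ, Adm h → ∀ γ₀ ∈ Set.Icc (0 : ℝ) γmax,
      sol h γ₀ 0 = γ₀ ∧
      ContinuousOn (sol h γ₀) (Set.Ici 0) ∧
      (∀ t ∈ Set.Ici (0 : ℝ), sol h γ₀ t ∈ Set.Icc 0 γmax) ∧
      (∀ t ∈ Set.Ici (0 : ℝ),
        sol h γ₀ t = γ₀ + ∫ s in (0 : ℝ)..t, f (sol h γ₀ s) (h s)))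
    (J : (ℝ → ℝ) → ℝ → ℝ)
    (hJ : ∀ (h : ℝ → ℝ) (γ₀ : ℝ), J h γ₀ =
      ∫ t in Set.Ioi (0 : ℝ), Real.exp (-δ * t) * (abar * sol h γ₀ t + c (h t)))
    (v : ℝ → ℝ)
    (hv : ∀ γ₀ ∈ Set.Icc (0 : ℝ) γmax,
      v γ₀ = sInf ((fun h => J h γ₀) '' {h : ℝ → ℝ | Adm h}))
    (v' : ℝ → ℝ)
    (hv_conc : ConcaveOn ℝ (Set.Icc 0 γmax) v)
    (hv'_deriv : ∀ x ∈ Set.Ioo (0 : ℝ) γmax, HasDerivAt v (v' x) x)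
    (hv'_cont : ContinuousOn v' (Set.Ioo 0 γmax))
    (hv'_zero : HasDerivWithinAt v (v' 0) (Set.Icc 0 γmax) 0)
    (hv'_gmax : HasDerivWithinAt v (v' γmax) (Set.Icc 0 γmax) γmax)
    (Hstar : ℝ → ℝ)
    (hHstar : ∀ γ ∈ Set.Icc (0 : ℝ) γmax,
      (γ ^ 2 * v' γ < c' 0 → Hstar γ = 0) ∧
      (c' 0 ≤ γ ^ 2 * v' γ →
        Hstar γ ∈ Set.Icc (0 : ℝ) hmax ∧ c' (Hstar γ) = γ ^ 2 * v' γ))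
    (γD : ℝ) (hγD_mem : γD ∈ Set.Icc (0 : ℝ) γmax)
    (hγD_char : ∀ γ ∈ Set.Icc (0 : ℝ) γmax, γ ^ 2 * v' γ ≤ c' 0 ↔ γ ≤ γD)
    (γeq : ℝ) (hγeq_mem : γeq ∈ Set.Icc (0 : ℝ) γinf)
    (hγeq_zero : f γeq (Hstar γeq) = 0)
    (hγeq_uniq : ∀ γ' ∈ Set.Icc (0 : ℝ) γinf, f γ' (Hstar γ') = 0 → γ' = γeq) :
    v γeq = (abar * γeq + c (Hstar γeq)) / δ ∧
    (γeq ≤ γD → Hstar γeq = 0) ∧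
    (0 < γeq → γeq < γD →
      v' γeq = abar / (2 * (1 / σ₁ ^ 2) * γeq + 2 * lam + δ)) ∧
    (γD < γeq →
      Hstar γeq = -(2 * lam * γeq - σ₂ ^ 2) / γeq ^ 2 - 1 / σ₁ ^ 2 ∧
      v' γeq = c' (Hstar γeq) / γeq ^ 2) := by
  have hγle : γeq < γmax := lt_of_le_of_lt hγeq_mem.2 hγmax
  have hγeqI : γeq ∈ Icc 0 γmax := ⟨hγeq_mem.1, hγle.le⟩
  have hγm0 : 0 ≤ γmax := hγeqI.1.trans hγeqI.2
  have hs : (0:ℝ) ≤ 1 / σ₁ ^ 2 := by positivity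
  set s : ℝ := 1 / σ₁ ^ 2 with hsdef
  have hc_cont : ContinuousOn c (Ici 0) := hc_smooth.continuousOn
  set K : ℝ := (s + hmax) * (2 * γmax) + 2 * lam with hKdef
  set B : ℝ := (s + hmax) * γmax ^ 2 + 2 * lam * γmax + σ₂ ^ 2 with hBdef
  have hK0 : 0 ≤ K := by positivity
  have hB0 : 0 ≤ B := by positivity
  have hfc : Continuous (Function.uncurry f) := by
    have : Function.uncurry f = fun q : ℝ × ℝ =>
        -(s + q.2) * q.1 ^ 2 - 2 * lam * q.1 + σ₂ ^ 2 := by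
      ext q; exact hf q.1 q.2
    rw [this]; fun_prop
  have hK : ∀ x ∈ Icc 0 γmax, ∀ y ∈ Icc 0 γmax, ∀ h ∈ Icc 0 hmax,
      |f x h - f y h| ≤ K * |x - y| := by
    intro x hx y hy h hh
    have e : f x h - f y h = -((s + h) * (x + y) + 2 * lam) * (x - y) := by
      rw [hf, hf]; ring
    have hx0 := hx.1
    have hy0 := hy.1
    have hh0 := hh.1
    rw [e, abs_mul, abs_neg, abs_of_nonneg (by positivity)]
    refine mul_le_mul_of_nonneg_right ?_ (abs_nonneg _)
    have : (s + h) * (x + y) ≤ (s + hmax) * (2 * γmax) := by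
      apply mul_le_mul <;> linarith [hx.2, hy.2, hh.2]
    linarith
  have hB : ∀ x ∈ Icc 0 γmax, ∀ h ∈ Icc 0 hmax, |f x h| ≤ B := by
    intro x hx h hh
    have hx0 := hx.1
    have hh0 := hh.1
    have h1 : (s + h) * x ^ 2 ≤ (s + hmax) * γmax ^ 2 := by
      have := hx.2
      have := hh.2
      gcongr
    have h2 : 2 * lam * x ≤ 2 * lam * γmax := by
      have := hx.2
      gcongr
    have h3 : 0 ≤ (s + h) * x ^ 2 := by positivity
    have h4 : 0 ≤ 2 * lam * x := by positivity
    have h5 := sq_nonneg σ₂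
    rw [hf, abs_le]
    constructor <;> linarith
  have super := aux_super δ abar γmax hmax hδ habar f hfc K B hK hB c hc_nonneg hc_cont
    hc_mono Adm hAdm sol hsol J hJ v hv hhmax.le hB0 hK0
  have hderivI : ∀ γ ∈ Icc 0 γmax, γ < γmax → HasDerivWithinAt v (v' γ) (Icc 0 γmax) γ := by
    intro γ hγ hlt
    rcases hγ.1.eq_or_lt with h0 | h0
    · rw [← h0]; exact hv'_zero
    · exact (hv'_deriv γ ⟨h0, hlt⟩).hasDerivWithinAt
  have hHmem : Hstar γeq ∈ Icc 0 hmax := by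
    rcases lt_or_ge (γeq ^ 2 * v' γeq) (c' 0) with h | h
    · rw [(hHstar γeq hγeqI).1 h]; exact ⟨le_rfl, hhmax.le⟩
    · exact ((hHstar γeq hγeqI).2 h).1
  -- the supersolution inequality at points with vanishing optimal control
  have superD : ∀ γ ∈ Ioo 0 γD, abar * γ + c 0 + v' γ * f γ 0 ≤ δ * v γ := by
    intro γ hγ
    have hlt : γ < γmax := hγ.2.trans_le hγD_mem.2
    have hI : γ ∈ Icc 0 γmax := ⟨hγ.1.le, hlt.le⟩
    refine super γ (v' γ) _ hI (hderivI γ hI hlt) ?_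
    intro h hh
    have h1 := (hγD_char γ hI).2 hγ.2.le
    have h2 := aux_tangent hc_conv hc_deriv le_rfl hh.1
    have h3 := mul_le_mul_of_nonneg_right h1 hh.1
    rw [hf, hf]
    linarith
  have hlower : abar * γeq + c (Hstar γeq) ≤ δ * v γeq := by
    refine super γeq (v' γeq) _ hγeqI (hderivI γeq hγeqI hγle) ?_
    intro h hh
    have e : f γeq h = f γeq h - f γeq (Hstar γeq) := by rw [hγeq_zero, sub_zero]
    have e2 : f γeq h - f γeq (Hstar γeq) = - γeq ^ 2 * (h - Hstar γeq) := by
      rw [hf, hf]; ring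
    rw [e, e2]
    have h2 := aux_tangent hc_conv hc_deriv hHmem.1 hh.1
    rcases lt_or_ge (γeq ^ 2 * v' γeq) (c' 0) with hlt | hge
    · rw [(hHstar γeq hγeqI).1 hlt] at h2 ⊢
      have h3 := mul_le_mul_of_nonneg_right hlt.le hh.1
      linarith
    · rw [((hHstar γeq hγeqI).2 hge).2] at h2
      linarith
  have hupper : v γeq ≤ (abar * γeq + c (Hstar γeq)) / δ := by
    have hadm : Adm (fun _ => Hstar γeq) := (hAdm _).2 ⟨measurable_const, fun _ => hHmem⟩
    obtain ⟨d1, -, d2, -⟩ := aux_dpp δ abar γmax hmax hδ habar f hfc K B hK hB c hc_nonneg hc_cont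
      hc_mono Adm hAdm sol hsol J hJ v hv _ hadm γeq hγeqI
    have hconst := d2 (fun _ => γeq) continuousOn_const (fun _ _ => hγeqI)
      (fun t _ => by simp [hγeq_zero])
    refine d1.trans (le_of_eq ?_)
    rw [hJ]
    have e : ∫ t in Ioi (0:ℝ), Real.exp (-δ * t) *
        (abar * sol (fun _ => Hstar γeq) γeq t + c (Hstar γeq)) =
        ∫ t in Ioi (0:ℝ), Real.exp (-δ * t) * (abar * γeq + c (Hstar γeq)) := by
      refine setIntegral_congr_fun measurableSet_Ioi fun t ht => ?_
      simp only [hconst t (le_of_lt ht)]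
    rw [e, integral_mul_const, integral_exp_mul_Ioi (by linarith)]
    simp
    field_simp
  have hval : v γeq = (abar * γeq + c (Hstar γeq)) / δ := by
    refine le_antisymm hupper ?_
    rw [div_le_iff₀ hδ]; linarith
  have hzero : γeq ≤ γD → Hstar γeq = 0 := by
    intro hle
    have h1 := (hγD_char γeq hγeqI).2 hle
    rcases h1.lt_or_eq with h | h
    · exact (hHstar γeq hγeqI).1 h
    · have h2 := (hHstar γeq hγeqI).2 h.ge
      exact aux_strict hc_conv hc_deriv h2.1.1 (h2.2.trans h)
  refine ⟨hval, hzero, ?_, ?_⟩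
  · intro hpos hlt
    have hH0 := hzero hlt.le
    have hf0 : f γeq 0 = 0 := by rwa [hH0] at hγeq_zero
    have hfd : HasDerivAt (fun γ => f γ 0) (-2 * s * γeq - 2 * lam) γeq := by
      have e : (fun γ => f γ 0) = fun γ => -(s + 0) * γ ^ 2 - 2 * lam * γ + σ₂ ^ 2 := by
        ext γ; exact hf γ 0
      rw [e]
      have := (((hasDerivAt_pow 2 γeq).const_mul (-(s + 0))).sub
        ((hasDerivAt_id γeq).const_mul (2 * lam))).add_const (σ₂ ^ 2)
      refine this.congr_deriv ?_
      push_cast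
      ring
    have hcont : ContinuousAt v' γeq :=
      hv'_cont.continuousAt (Ioo_mem_nhds hpos hγle)
    have hprod : HasDerivAt (fun γ => v' γ * f γ 0) (v' γeq * (-2 * s * γeq - 2 * lam)) γeq := by
      rw [hasDerivAt_iff_tendsto_slope] at hfd ⊢
      have h1 := (hcont.tendsto.mono_left (nhdsWithin_le_nhds (s := {γeq}ᶜ))).mul hfd
      refine h1.congr fun γ => ?_
      rw [slope_def_field, slope_def_field, hf0]; ring
    have hg : HasDerivAt (fun γ => δ * v γ - abar * γ - v' γ * f γ 0)
        (δ * v' γeq - abar * 1 - v' γeq * (-2 * s * γeq - 2 * lam)) γeq :=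
      (((hv'_deriv γeq ⟨hpos, hγle⟩).const_mul δ).sub
        ((hasDerivAt_id γeq).const_mul abar)).sub hprod
    have hmin : IsLocalMin (fun γ => δ * v γ - abar * γ - v' γ * f γ 0) γeq := by
      filter_upwards [Ioo_mem_nhds hpos hlt] with γ hγ
      have h1 := superD γ hγ
      have h2 : δ * v γeq = abar * γeq + c 0 := by
        rw [hval, hH0]; field_simp
      rw [hf0, h2]
      linarith
    have h0 := hmin.hasDerivAt_eq_zero hg
    rw [eq_div_iff (by positivity)]
    linarith
  · intro hlt
    have hpos : 0 < γeq := hγD_mem.1.trans_lt hlt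
    have hn : ¬ γeq ^ 2 * v' γeq ≤ c' 0 := fun h =>
      absurd ((hγD_char γeq hγeqI).1 h) (not_le.2 hlt)
    have h2 := (hHstar γeq hγeqI).2 (not_le.1 hn).le
    constructor
    · rw [hf] at hγeq_zero
      have : Hstar γeq * γeq ^ 2 = -(2 * lam * γeq - σ₂ ^ 2) - s * γeq ^ 2 := by linarith
      rw [eq_sub_iff_add_eq, eq_div_iff (by positivity)]
      linarith
    · rw [h2.2]; field_simp
end
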